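/- For every r > 0 there exist real coefficients b₀₀, b₂₀, b₀₂, b₄₀, b₂₂, b₀₄, b₆₀, b₄₂, b₂₄, b₀₆ such that the degree-9 Kukles system (E) has at least 9 limit cycles, with pairwise distinct images all contained in the open ball of radius r centered at the origin: there exist 9 nonconstant periodic solutions with pairwise distinct images Γ₁, …, Γ₉ ⊂ {(x,y) : x² + y² < r²}, each Γ_k having an open neighborhood U_k such that every nonconstant periodic solution with image contained in U_k has image equal to Γ_k. -/

import Mathlib

/-- `γ` is a solution of the degree-9 Kukles system
`ẋ = −y, ẏ = x + y(1−x²−y²)(b₀₀ + b₂₀x² + b₀₂y² + b₄₀x⁴ + b₂₂x²y² + b₀₄y⁴ + b₆₀x⁶ + b₄₂x⁴y² + b₂₄x²y⁴ + b₀₆y⁶)`. -/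
def IsKukles9Sol (b00 b20 b02 b40 b22 b04 b60 b42 b24 b06 : ℝ)
    (γ : ℝ → ℝ × ℝ) : Prop :=
  ∀ t : ℝ, HasDerivAt γ
    (-(γ t).2,
      (γ t).1 + (γ t).2 * (1 - (γ t).1 ^ 2 - (γ t).2 ^ 2) *
        (b00 + b20 * (γ t).1 ^ 2 + b02 * (γ t).2 ^ 2
          + b40 * (γ t).1 ^ 4 + b22 * (γ t).1 ^ 2 * (γ t).2 ^ 2
          + b04 * (γ t).2 ^ 4 + b60 * (γ t).1 ^ 6
          + b42 * (γ t).1 ^ 4 * (γ t).2 ^ 2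
          + b24 * (γ t).1 ^ 2 * (γ t).2 ^ 4 + b06 * (γ t).2 ^ 6)) t

/-- `γ` is periodic: `γ(t+T) = γ(t)` for some `T > 0`. -/
def IsPeriodicCurve (γ : ℝ → ℝ × ℝ) : Prop :=
  ∃ T > (0:ℝ), ∀ t : ℝ, γ (t + T) = γ t

/-- `γ` is nonconstant. -/
def IsNonconstCurve (γ : ℝ → ℝ × ℝ) : Prop :=
  ∃ t s : ℝ, γ t ≠ γ s

open Set Metric

/-- Global flow (on a window) for a scalar ODE that is Lipschitz and bounded on a compact interval. -/
lemma kk_scalar_flow (c δ M : ℝ) (K : NNReal) (hδ : 0 < δ) (hM0 : 0 ≤ M) (hM : 8 * M ≤ δ / 4)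
    (f : ℝ → ℝ → ℝ) (hcont : ∀ R ∈ Icc (c - δ) (c + δ), Continuous (fun θ => f θ R))
    (hLip : ∀ θ, LipschitzOnWith K (f θ) (Icc (c - δ) (c + δ)))
    (hbd : ∀ θ, ∀ R ∈ Icc (c - δ) (c + δ), |f θ R| ≤ M) :
    ∃ α : ℝ → ℝ → ℝ, ∃ L : NNReal,
      (∀ x ∈ closedBall c (δ / 2), α x 0 = x ∧ ∀ t ∈ Ioo (-8 : ℝ) 8,
        HasDerivAt (α x) (f t (α x t)) t ∧ |α x t - x| ≤ δ / 4) ∧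
      ∀ t ∈ Ioo (-8 : ℝ) 8, LipschitzOnWith L (α · t) (closedBall c (δ / 2)) := by
  have hle : c - δ ≤ c + δ := by linarith
  let g : ℝ → ℝ → ℝ := fun θ R => f θ (projIcc (c - δ) (c + δ) hle R)
  have hg : ∀ θ, LipschitzWith K (g θ) := by
    intro θ
    have h1 := (hLip θ).to_restrict
    have h2 := h1.comp (LipschitzWith.projIcc hle)
    simpa [g, Function.comp_def, Set.domRestrict] using h2
  have hgb : ∀ θ R, |g θ R| ≤ M := fun θ R => hbd θ _ (projIcc (c - δ) (c + δ) hle R).2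
  have hz : (0 : ℝ) ∈ Icc (-8 : ℝ) 8 := by constructor <;> norm_num
  have hPL : IsPicardLindelof g (⟨0, hz⟩ : Icc (-8 : ℝ) 8) c ⟨δ, hδ.le⟩ ⟨δ / 2, by positivity⟩
      ⟨M, hM0⟩ K := by
    refine ⟨fun t _ => (hg t).lipschitzOnWith, fun x _ => ?_, fun t _ x _ => ?_, ?_⟩
    · exact (hcont _ (projIcc (c - δ) (c + δ) hle x).2).continuousOn
    · exact hgb t x
    · have : max ((8 : ℝ) - 0) (0 - (-8)) = 8 := by norm_num
      change M * max ((8 : ℝ) - 0) (0 - (-8)) ≤ δ - δ / 2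
      rw [this]
      linarith
  obtain ⟨α, h1, L, h2⟩ := hPL.exists_forall_mem_closedBall_eq_hasDerivWithinAt_lipschitzOnWith
  refine ⟨α, L, fun x hx => ?_, fun t ht => h2 t (Ioo_subset_Icc_self ht)⟩
  obtain ⟨hx0, hxd⟩ := h1 x hx
  refine ⟨hx0, fun t ht => ?_⟩
  have hb : ∀ t ∈ Icc (-8 : ℝ) 8, |α x t - x| ≤ δ / 4 := by
    intro t ht
    have := (convex_Icc (-8 : ℝ) 8).norm_image_sub_le_of_norm_hasDerivWithin_le
      (f := α x) (f' := fun t => g t (α x t)) (C := M) (fun s hs => hxd s hs)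
      (fun s _ => hgb s _) hz ht
    simp only [Real.norm_eq_abs, sub_zero] at this
    have h0 : α x 0 = x := hx0
    rw [h0] at this
    have h8 : |t| ≤ 8 := abs_le.2 ht
    nlinarith
  have hb' := hb t (Ioo_subset_Icc_self ht)
  refine ⟨?_, hb'⟩
  have hd := (hxd t (Ioo_subset_Icc_self ht)).hasDerivAt (Icc_mem_nhds ht.1 ht.2)
  have hmem : α x t ∈ Icc (c - δ) (c + δ) := by
    rw [mem_closedBall, Real.dist_eq] at hx
    have := abs_le.1 hb'
    have := abs_le.1 hx
    constructor <;> linarith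
  have : g t (α x t) = f t (α x t) := by
    simp only [g]
    rw [projIcc_of_mem hle hmem]
  rwa [this] at hd

/-- Periodic extension of a solution of a periodic scalar ODE. -/
lemma kk_periodic_ext (f : ℝ → ℝ → ℝ) (hper : ∀ θ R, f (θ + 2 * Real.pi) R = f θ R)
    (K : NNReal) (s : Set ℝ) (hLip : ∀ θ, LipschitzOnWith K (f θ) s)
    (α : ℝ → ℝ) (hα : ∀ t ∈ Ioo (-8 : ℝ) 8, HasDerivAt α (f t (α t)) t ∧ α t ∈ s)
    (hα0 : α (2 * Real.pi) = α 0) :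
    ∃ ρ : ℝ → ℝ, (∀ θ, HasDerivAt ρ (f θ (ρ θ)) θ) ∧ (∀ θ, ρ θ ∈ s) ∧
      (∀ θ, ρ (θ + 2 * Real.pi) = ρ θ) := by
  have hpi := Real.pi_gt_three
  have hpi4 := Real.pi_lt_d2
  have hp : (0 : ℝ) < 2 * Real.pi := by positivity
  -- local periodicity
  have hloc : EqOn (fun t => α (t + 2 * Real.pi)) α (Ioo (-1) 1) := by
    refine ODE_solution_unique_of_mem_Ioo (v := f) (s := fun _ => s) (K := K) (t₀ := 0)
      (fun t _ => hLip t) (by constructor <;> norm_num) (fun t ht => ?_) (fun t ht => ?_) ?_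
    · have hm : t + 2 * Real.pi ∈ Ioo (-8 : ℝ) 8 := by
        constructor <;> [linarith [ht.1]; linarith [ht.2]]
      obtain ⟨hd, hs⟩ := hα _ hm
      refine ⟨?_, hs⟩
      rw [hper] at hd
      exact hd.comp_add_const t (2 * Real.pi)
    · exact hα t ⟨by linarith [ht.1], by linarith [ht.2]⟩
    · simpa using hα0
  have hfper : ∀ (n : ℤ) θ R, f (θ - n * (2 * Real.pi)) R = f θ R := by
    intro n θ R
    have : Function.Periodic (fun θ => f θ R) (2 * Real.pi) := fun θ => hper θ R
    exact this.sub_int_mul_eq n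
  let ρ : ℝ → ℝ := fun θ => α (θ - ⌊θ / (2 * Real.pi)⌋ * (2 * Real.pi))
  have hfl : ∀ θ : ℝ, θ - ⌊θ / (2 * Real.pi)⌋ * (2 * Real.pi) ∈ Ico 0 (2 * Real.pi) := by
    intro θ
    have h1 := Int.floor_le (θ / (2 * Real.pi))
    have h2 := Int.lt_floor_add_one (θ / (2 * Real.pi))
    rw [le_div_iff₀ hp] at h1
    rw [div_lt_iff₀ hp] at h2
    constructor <;> linarith
  -- near every point, ρ agrees with a translate of α
  have hnear : ∀ (n : ℤ) (θ : ℝ), θ - n * (2 * Real.pi) ∈ Ioo (-1) (2 * Real.pi) →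
      ρ θ = α (θ - n * (2 * Real.pi)) := by
    intro n θ h
    rcases lt_or_ge (θ - n * (2 * Real.pi)) 0 with h0 | h0
    · have hn : ⌊θ / (2 * Real.pi)⌋ = n - 1 := by
        rw [Int.floor_eq_iff, le_div_iff₀ hp, div_lt_iff₀ hp]
        push_cast
        constructor <;> linarith [h.1]
      have : ρ θ = α ((θ - n * (2 * Real.pi)) + 2 * Real.pi) := by
        simp only [ρ, hn]
        congr 1
        push_cast
        ring
      rw [this]
      exact hloc ⟨h.1, by linarith⟩
    · have hn : ⌊θ / (2 * Real.pi)⌋ = n := by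
        rw [Int.floor_eq_iff, le_div_iff₀ hp, div_lt_iff₀ hp]
        constructor <;> linarith [h.2]
      simp only [ρ, hn]
  refine ⟨ρ, fun θ => ?_, fun θ => ?_, fun θ => ?_⟩
  · set n := ⌊θ / (2 * Real.pi)⌋ with hn
    have h := hfl θ
    rw [← hn] at h
    have hev : ρ =ᶠ[nhds θ] fun t => α (t - n * (2 * Real.pi)) := by
      have : ∀ᶠ t in nhds θ, t - n * (2 * Real.pi) ∈ Ioo (-1) (2 * Real.pi) := by
        apply (ContinuousAt.sub continuousAt_id continuousAt_const).eventually_mem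
        exact Ioo_mem_nhds (by change (-1 : ℝ) < θ - n * (2 * Real.pi); linarith [h.1]) h.2
      filter_upwards [this] with t ht using hnear n t ht
    have hd := (hα (θ - n * (2 * Real.pi)) ⟨by linarith [h.1], by linarith [h.2]⟩).1
    rw [hfper] at hd
    have hd2 := hd.comp_sub_const θ (n * (2 * Real.pi))
    exact hd2.congr_of_eventuallyEq hev
  · have h := hfl θ
    exact (hα _ ⟨by linarith [h.1], by linarith [h.2]⟩).2
  · have h1 := hfl θ
    have := hnear (⌊θ / (2 * Real.pi)⌋ + 1) (θ + 2 * Real.pi) (by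
      push_cast
      constructor <;> [linarith [h1.1]; linarith [h1.2]])
    rw [this]
    simp only [ρ]
    congr 1
    push_cast
    ring

lemma kk_scalar_periodic (c δ M : ℝ) (K : NNReal) (hδ : 0 < δ) (hM0 : 0 ≤ M)
    (hM : 8 * M ≤ δ / 4)
    (f : ℝ → ℝ → ℝ) (hcont : ∀ R ∈ Icc (c - δ) (c + δ), Continuous (fun θ => f θ R))
    (hLip : ∀ θ, LipschitzOnWith K (f θ) (Icc (c - δ) (c + δ)))
    (hbd : ∀ θ, ∀ R ∈ Icc (c - δ) (c + δ), |f θ R| ≤ M)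
    (hper : ∀ θ R, f (θ + 2 * Real.pi) R = f θ R)
    (V H : ℝ → ℝ → ℝ) (hV0 : ∀ R, V R 0 = R) (hVper : ∀ R θ, V R (θ + 2 * Real.pi) = V R θ)
    (lam : ℝ) (hlam : lam ≠ 0)
    (hVd : ∀ (ρ : ℝ → ℝ) (θ : ℝ), ρ θ ∈ Icc (c - δ) (c + δ) → HasDerivAt ρ (f θ (ρ θ)) θ →
      HasDerivAt (fun t => V (ρ t) t) (lam * H (ρ θ) θ) θ)
    (hneg : ∀ R ∈ Icc (c - δ) (c - δ / 4), ∀ θ, H R θ < 0)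
    (hpos : ∀ R ∈ Icc (c + δ / 4) (c + δ), ∀ θ, 0 < H R θ)
    (hmono : ∀ θ, StrictMonoOn (fun R => H R θ) (Icc (c - δ) (c + δ))) :
    ∃ ρ : ℝ → ℝ, (∀ θ, HasDerivAt ρ (f θ (ρ θ)) θ) ∧ (∀ θ, ρ θ ∈ Ioo (c - δ) (c + δ)) ∧
      (∀ θ, ρ (θ + 2 * Real.pi) = ρ θ) ∧
      ∀ ρ2 : ℝ → ℝ, (∀ θ, HasDerivAt ρ2 (f θ (ρ2 θ)) θ) → (∀ θ, ρ2 θ ∈ Ioo (c - δ) (c + δ)) →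
        ∀ n : ℕ, 0 < n → (∀ θ, ρ2 (θ + n * (2 * Real.pi)) = ρ2 θ) → ρ2 = ρ := by
  have hpi := Real.pi_gt_three
  have hpi4 := Real.pi_lt_d2
  have hp : (0 : ℝ) < 2 * Real.pi := by positivity
  obtain ⟨α, L, hα, hαL⟩ := kk_scalar_flow c δ M K hδ hM0 hM f hcont hLip hbd
  have h2p : 2 * Real.pi ∈ Ioo (-8 : ℝ) 8 := by constructor <;> linarith
  have hmem : ∀ x ∈ closedBall c (δ / 2), ∀ t ∈ Ioo (-8 : ℝ) 8,
      α x t ∈ Ioo (c - δ) (c + δ) := by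
    intro x hx t ht
    have h1 := abs_le.1 ((hα x hx).2 t ht).2
    rw [mem_closedBall, Real.dist_eq] at hx
    have h2 := abs_le.1 hx
    constructor <;> linarith
  -- displacement
  have hdisp : ∀ x ∈ closedBall c (δ / 2), ∃ ξ ∈ Ioo 0 (2 * Real.pi),
      α x (2 * Real.pi) - x = 2 * Real.pi * (lam * H (α x ξ) ξ) := by
    intro x hx
    have hsub : ∀ t ∈ Icc 0 (2 * Real.pi), t ∈ Ioo (-8 : ℝ) 8 := fun t ht =>
      ⟨by linarith [ht.1], by linarith [ht.2]⟩
    have hd : ∀ t ∈ Icc 0 (2 * Real.pi),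
        HasDerivAt (fun t => V (α x t) t) (lam * H (α x t) t) t := fun t ht =>
      hVd _ _ (Ioo_subset_Icc_self (hmem x hx t (hsub t ht))) ((hα x hx).2 t (hsub t ht)).1
    obtain ⟨ξ, hξ, he⟩ := exists_hasDerivAt_eq_slope (fun t => V (α x t) t)
      (fun t => lam * H (α x t) t) hp (fun t ht => (hd t ht).continuousAt.continuousWithinAt)
      (fun t ht => hd t (Ioo_subset_Icc_self ht))
    refine ⟨ξ, hξ, ?_⟩
    have e1 : V (α x (2 * Real.pi)) (2 * Real.pi) = α x (2 * Real.pi) := by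
      have := hVper (α x (2 * Real.pi)) 0
      rw [zero_add, hV0] at this
      exact this
    rw [he, e1, hV0, (hα x hx).1]
    field_simp
    ring
  -- a fixed point
  have hfix : ∃ x ∈ closedBall c (δ / 2), α x (2 * Real.pi) = x := by
    have hcb : closedBall c (δ / 2) = Icc (c - δ / 2) (c + δ / 2) := Real.closedBall_eq_Icc
    have hc : ContinuousOn (fun x => (α x (2 * Real.pi) - x) / lam)
        (Icc (c - δ / 2) (c + δ / 2)) := by
      rw [← hcb]
      exact ((hαL _ h2p).continuousOn.sub continuousOn_id).div_const _
    have hl : c - δ / 2 ∈ closedBall c (δ / 2) := by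
      rw [hcb]; constructor <;> linarith
    have hr : c + δ / 2 ∈ closedBall c (δ / 2) := by
      rw [hcb]; constructor <;> linarith
    have vl : (α (c - δ / 2) (2 * Real.pi) - (c - δ / 2)) / lam ≤ 0 := by
      obtain ⟨ξ, hξ, he⟩ := hdisp _ hl
      have hξm : ξ ∈ Ioo (-8 : ℝ) 8 := ⟨by linarith [hξ.1], by linarith [hξ.2]⟩
      have h1 := hmem _ hl ξ hξm
      have h2 := abs_le.1 ((hα _ hl).2 ξ hξm).2
      have h3 := hneg (α (c - δ / 2) ξ) ⟨h1.1.le, by linarith⟩ ξ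
      rw [he]
      have : 2 * Real.pi * (lam * H (α (c - δ / 2) ξ) ξ) / lam
          = 2 * Real.pi * H (α (c - δ / 2) ξ) ξ := by field_simp
      rw [this]
      nlinarith
    have vr : 0 ≤ (α (c + δ / 2) (2 * Real.pi) - (c + δ / 2)) / lam := by
      obtain ⟨ξ, hξ, he⟩ := hdisp _ hr
      have hξm : ξ ∈ Ioo (-8 : ℝ) 8 := ⟨by linarith [hξ.1], by linarith [hξ.2]⟩
      have h1 := hmem _ hr ξ hξm
      have h2 := abs_le.1 ((hα _ hr).2 ξ hξm).2
      have h3 := hpos (α (c + δ / 2) ξ) ⟨by linarith, h1.2.le⟩ ξ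
      rw [he]
      have : 2 * Real.pi * (lam * H (α (c + δ / 2) ξ) ξ) / lam
          = 2 * Real.pi * H (α (c + δ / 2) ξ) ξ := by field_simp
      rw [this]
      positivity
    obtain ⟨x, hx, hx0⟩ := intermediate_value_Icc (by linarith) hc ⟨vl, vr⟩
    refine ⟨x, by rw [hcb]; exact hx, ?_⟩
    simp only [div_eq_zero_iff, hlam, or_false] at hx0
    linarith
  obtain ⟨x, hx, hxf⟩ := hfix
  obtain ⟨ρ, hρd, hρm, hρp⟩ := kk_periodic_ext f hper K (Ioo (c - δ) (c + δ))
    (fun θ => (hLip θ).mono Ioo_subset_Icc_self) (α x)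
    (fun t ht => ⟨((hα x hx).2 t ht).1, hmem x hx t ht⟩) (by rw [hxf, (hα x hx).1])
  refine ⟨ρ, hρd, hρm, hρp, fun ρ2 h2d h2m n hn h2p => ?_⟩
  by_contra hne
  have hnever : ∀ θ, ρ2 θ ≠ ρ θ := by
    intro θ he
    exact hne (ODE_solution_unique_univ (v := f) (s := fun _ => Ioo (c - δ) (c + δ)) (K := K)
      (t₀ := θ) (fun θ => (hLip θ).mono Ioo_subset_Icc_self) (fun t => ⟨h2d t, h2m t⟩)
      (fun t => ⟨hρd t, hρm t⟩) he)
  have hnp : (0 : ℝ) < n * (2 * Real.pi) := by positivity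
  have hρnp : ∀ θ, ρ (θ + n * (2 * Real.pi)) = ρ θ := by
    have : Function.Periodic ρ (2 * Real.pi) := hρp
    exact this.nat_mul n
  have hVnp : ∀ R, V R (n * (2 * Real.pi)) = V R 0 := by
    intro R
    have : Function.Periodic (V R) (2 * Real.pi) := hVper R
    have := this.nat_mul n 0
    simpa using this
  have hD : ∀ t, HasDerivAt (fun t => V (ρ2 t) t - V (ρ t) t)
      (lam * H (ρ2 t) t - lam * H (ρ t) t) t := fun t =>
    (hVd _ _ (Ioo_subset_Icc_self (h2m t)) (h2d t)).sub
      (hVd _ _ (Ioo_subset_Icc_self (hρm t)) (hρd t))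
  obtain ⟨ξ, hξ, he⟩ := exists_hasDerivAt_eq_zero (f := fun t => V (ρ2 t) t - V (ρ t) t) hnp
    (fun t _ => (hD t).continuousAt.continuousWithinAt) (by
      have e1 := h2p 0
      have e2 := hρnp 0
      rw [zero_add] at e1 e2
      simp only [e1, e2, hVnp]) (fun t _ => hD t)
  have he' : H (ρ2 ξ) ξ = H (ρ ξ) ξ := by
    have : lam * (H (ρ2 ξ) ξ - H (ρ ξ) ξ) = 0 := by linarith
    rcases mul_eq_zero.1 this with h | h
    · exact absurd h hlam
    · linarith
  exact hnever ξ ((hmono ξ).injOn (Ioo_subset_Icc_self (h2m ξ)) (Ioo_subset_Icc_self (hρm ξ)) he')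

open Set Metric

lemma kk_time_change (h ω : ℝ → ℝ) (hd : ∀ t, HasDerivAt h (ω t) t) (hω : ∀ t, 1 / 2 ≤ ω t) :
    ∃ τ : ℝ → ℝ, (∀ θ, h (τ θ) = θ) ∧ (∀ t, τ (h t) = t) ∧
      ∀ θ, HasDerivAt τ (ω (τ θ))⁻¹ θ := by
  have hmono : StrictMono h := by
    apply strictMono_of_deriv_pos
    intro t
    rw [(hd t).deriv]
    linarith [hω t]
  have hcont : Continuous h := continuous_iff_continuousAt.2 fun t => (hd t).continuousAt
  have hm2 : Monotone (fun t => h t - t / 2) := by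
    apply monotone_of_deriv_nonneg
    · exact fun t => ((hd t).sub ((hasDerivAt_id t).div_const 2)).differentiableAt
    · intro t
      have := ((hd t).sub ((hasDerivAt_id t).div_const 2)).deriv
      have e : deriv (fun t => h t - t / 2) t = ω t - 1 / 2 := this
      rw [e]
      linarith [hω t]
  have htop : Filter.Tendsto h Filter.atTop Filter.atTop := by
    have h1 : Filter.Tendsto (fun t : ℝ => h 0 + t / 2) Filter.atTop Filter.atTop :=
      Filter.tendsto_atTop_add_const_left _ _ (Filter.tendsto_id.atTop_div_const (by norm_num))
    refine Filter.tendsto_atTop_mono' _ ?_ h1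
    filter_upwards [Filter.eventually_ge_atTop 0] with t ht
    have := hm2 ht
    simp only at this
    linarith
  have hbot : Filter.Tendsto h Filter.atBot Filter.atBot := by
    have h1 : Filter.Tendsto (fun t : ℝ => h 0 + t / 2) Filter.atBot Filter.atBot :=
      Filter.tendsto_atBot_add_const_left _ _ (Filter.tendsto_id.atBot_div_const (by norm_num))
    refine Filter.tendsto_atBot_mono' _ ?_ h1
    filter_upwards [Filter.eventually_le_atBot 0] with t ht
    have := hm2 ht
    simp only at this
    linarith
  have hsurj : Function.Surjective h := hcont.surjective htop hbot
  let e := hmono.orderIsoOfSurjective h hsurj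
  refine ⟨e.symm, fun θ => ?_, fun t => ?_, fun θ => ?_⟩
  · exact e.apply_symm_apply θ
  · exact e.symm_apply_apply t
  · refine HasDerivAt.of_local_left_inverse (f := h) e.symm.continuous.continuousAt (hd _) ?_ ?_
    · linarith [hω (e.symm θ)]
    · exact Filter.Eventually.of_forall fun y => e.apply_symm_apply y

/-- Solutions of the planar system `x' = -y, y' = x + y Q(x,y)`. -/
def KkSol (Q : ℝ → ℝ → ℝ) (γ : ℝ → ℝ × ℝ) : Prop :=
  ∀ t : ℝ, HasDerivAt γ (-(γ t).2, (γ t).1 + (γ t).2 * Q (γ t).1 (γ t).2) t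

lemma kk_planar_of_scalar (Q : ℝ → ℝ → ℝ) (hQ : Continuous (fun p : ℝ × ℝ => Q p.1 p.2))
    (G : ℝ → ℝ → ℝ)
    (hG : ∀ R θ, 0 < R → Q (√R * Real.cos θ) (√R * Real.sin θ) = G R θ)
    (lo hi : ℝ) (hlo : 0 < lo) (hG1 : ∀ R ∈ Ioo lo hi, ∀ θ, |G R θ| ≤ 1)
    (ρ : ℝ → ℝ) (hρ : ∀ θ, HasDerivAt ρ (ρ θ * (1 - Real.cos (2 * θ)) * G (ρ θ) θ /
      (1 + Real.sin (2 * θ) / 2 * G (ρ θ) θ)) θ)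
    (hρm : ∀ θ, ρ θ ∈ Ioo lo hi) (hρp : ∀ θ, ρ (θ + 2 * Real.pi) = ρ θ) :
    ∃ γ : ℝ → ℝ × ℝ, KkSol Q γ ∧ IsPeriodicCurve γ ∧ IsNonconstCurve γ ∧
      range γ = range (fun θ => (√(ρ θ) * Real.cos θ, √(ρ θ) * Real.sin θ)) := by
  have hpos : ∀ θ, 0 < ρ θ := fun θ => hlo.trans (hρm θ).1
  have hρc : Continuous ρ := continuous_iff_continuousAt.2 fun t => (hρ t).continuousAt
  let w : ℝ → ℝ := fun θ => 1 + Real.sin (2 * θ) / 2 * G (ρ θ) θ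
  have hwc : Continuous w := by
    have : w = fun θ => 1 + Real.sin (2 * θ) / 2 *
        Q (√(ρ θ) * Real.cos θ) (√(ρ θ) * Real.sin θ) := by
      funext θ
      simp only [w, hG _ _ (hpos θ)]
    rw [this]
    have h2 : Continuous (fun θ => Q (√(ρ θ) * Real.cos θ) (√(ρ θ) * Real.sin θ)) :=
      hQ.comp (f := fun θ => (√(ρ θ) * Real.cos θ, √(ρ θ) * Real.sin θ)) (by fun_prop)
    fun_prop
  have hwb : ∀ θ, 1 / 2 ≤ w θ ∧ w θ ≤ 3 / 2 := by
    intro θ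
    have h1 := abs_le.1 (hG1 _ (hρm θ) θ)
    have h2 : |Real.sin (2 * θ) * G (ρ θ) θ| ≤ 1 := by
      rw [abs_mul]
      exact mul_le_one₀ (Real.abs_sin_le_one _) (abs_nonneg _) (hG1 _ (hρm θ) θ)
    have h3 := abs_le.1 h2
    constructor <;> simp only [w] <;> linarith
  have hwi : Continuous (fun θ => (w θ)⁻¹) := hwc.inv₀ fun θ => by linarith [(hwb θ).1]
  let h : ℝ → ℝ := fun θ => ∫ s in (0 : ℝ)..θ, (w s)⁻¹
  have hd : ∀ θ, HasDerivAt h (w θ)⁻¹ θ := fun θ => hwi.integral_hasStrictDerivAt 0 θ |>.hasDerivAt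
  obtain ⟨τ, hτ1, hτ2, hτd⟩ := kk_time_change h (fun θ => (w θ)⁻¹) hd (fun θ => by
    rw [one_div]
    exact inv_anti₀ (by linarith [(hwb θ).1]) (by linarith [(hwb θ).2]))
  simp only [inv_inv] at hτd
  have hwp : Function.Periodic (fun θ => (w θ)⁻¹) (2 * Real.pi) := by
    intro θ
    have hg : G (ρ θ) (θ + 2 * Real.pi) = G (ρ θ) θ := by
      rw [← hG _ _ (hpos θ), ← hG _ _ (hpos θ), Real.cos_add_two_pi, Real.sin_add_two_pi]
    simp only [w, hρp, hg]
    rw [show 2 * (θ + 2 * Real.pi) = 2 * θ + 2 * Real.pi + 2 * Real.pi by ring,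
      Real.sin_add_two_pi, Real.sin_add_two_pi]
  have hadd : ∀ θ, h (θ + 2 * Real.pi) = h θ + h (2 * Real.pi) := by
    intro θ
    have hii : ∀ a b : ℝ, IntervalIntegrable (fun θ => (w θ)⁻¹) MeasureTheory.volume a b :=
      fun a b => hwi.intervalIntegrable a b
    have e1 := intervalIntegral.integral_add_adjacent_intervals (hii 0 θ) (hii θ (θ + 2 * Real.pi))
    have e2 := hwp.intervalIntegral_add_eq θ 0
    rw [zero_add] at e2
    simp only [h]
    rw [← e1, e2]
  have hTpos : 0 < h (2 * Real.pi) := by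
    have hp : (0 : ℝ) < 2 * Real.pi := by positivity
    have hsm : StrictMono h := by
      apply strictMono_of_deriv_pos
      intro t
      rw [(hd t).deriv]
      exact inv_pos.2 (by linarith [(hwb t).1])
    have := hsm hp
    simpa [h] using this
  let cur : ℝ → ℝ × ℝ := fun θ => (√(ρ θ) * Real.cos θ, √(ρ θ) * Real.sin θ)
  have hτsurj : Function.Surjective τ := fun t => ⟨h t, hτ2 t⟩
  have hτp : ∀ t, τ (t + h (2 * Real.pi)) = τ t + 2 * Real.pi := by
    intro t
    rw [← hτ2 (τ t + 2 * Real.pi), hadd, hτ1]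
  refine ⟨fun t => cur (τ t), ?_, ⟨h (2 * Real.pi), hTpos, fun t => ?_⟩, ?_, ?_⟩
  · intro t
    set θ := τ t with hθ
    have hw := hτd t
    rw [← hθ] at hw
    have hR : HasDerivAt (fun t => ρ (τ t)) (ρ θ * (1 - Real.cos (2 * θ)) * G (ρ θ) θ) t := by
      have h0 : HasDerivAt ρ _ (τ t) := hρ (τ t)
      have := h0.comp t (hτd t)
      refine this.congr_deriv ?_
      rw [← hθ]
      have : w θ ≠ 0 := by linarith [(hwb θ).1]
      exact div_mul_cancel₀ _ this
    have hne : ρ (τ t) ≠ 0 := (hpos _).ne'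
    have hs := hR.sqrt hne
    have hsq : √(ρ θ) * √(ρ θ) = ρ θ := Real.mul_self_sqrt (hpos θ).le
    have hsp : 0 < √(ρ θ) := Real.sqrt_pos.2 (hpos θ)
    have hx := hs.mul hw.cos
    have hy := hs.mul hw.sin
    have hxy := hx.prodMk hy
    have hc2 := Real.sin_sq_add_cos_sq θ
    rw [← hθ] at hxy
    have hdiv : ρ θ * (1 - Real.cos (2 * θ)) * G (ρ θ) θ / (2 * √(ρ θ))
        = √(ρ θ) * Real.sin θ ^ 2 * G (ρ θ) θ := by
      rw [div_eq_iff (by positivity), Real.cos_two_mul]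
      have : Real.cos θ ^ 2 = 1 - Real.sin θ ^ 2 := by linarith
      rw [this]
      linear_combination (-2 * Real.sin θ ^ 2 * G (ρ θ) θ) * hsq
    refine hxy.congr_deriv ?_
    simp only [cur, ← hθ, hG _ _ (hpos θ), w]
    rw [hdiv, Real.sin_two_mul]
    ext
    · simp only
      ring
    · simp only
      linear_combination (√(ρ θ) * Real.sin θ * G (ρ θ) θ) * hc2
  · simp only [cur, hτp, hρp, Real.cos_add_two_pi, Real.sin_add_two_pi]
  · obtain ⟨t, ht⟩ := hτsurj 0
    obtain ⟨s, hs⟩ := hτsurj Real.pi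
    refine ⟨t, s, fun he => ?_⟩
    have := congrArg Prod.fst he
    simp only [cur, ht, hs, Real.cos_zero, Real.cos_pi] at this
    have h1 := Real.sqrt_pos.2 (hpos 0)
    have h2 := Real.sqrt_pos.2 (hpos Real.pi)
    linarith
  · exact hτsurj.range_comp cur

lemma kk_scalar_of_planar (Q : ℝ → ℝ → ℝ) (hQ : Continuous (fun p : ℝ × ℝ => Q p.1 p.2))
    (G : ℝ → ℝ → ℝ)
    (hG : ∀ R θ, 0 < R → Q (√R * Real.cos θ) (√R * Real.sin θ) = G R θ)
    (lo hi : ℝ) (hlo : 0 < lo) (hG1 : ∀ R ∈ Ioo lo hi, ∀ θ, |G R θ| ≤ 1)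
    (γ : ℝ → ℝ × ℝ) (hγ : KkSol Q γ) (hper : IsPeriodicCurve γ)
    (hm : ∀ t, (γ t).1 ^ 2 + (γ t).2 ^ 2 ∈ Ioo lo hi) :
    ∃ ρ : ℝ → ℝ, (∀ θ, HasDerivAt ρ (ρ θ * (1 - Real.cos (2 * θ)) * G (ρ θ) θ /
      (1 + Real.sin (2 * θ) / 2 * G (ρ θ) θ)) θ) ∧ (∀ θ, ρ θ ∈ Ioo lo hi) ∧
      (∃ n : ℕ, 0 < n ∧ ∀ θ, ρ (θ + n * (2 * Real.pi)) = ρ θ) ∧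
      range γ = range (fun θ => (√(ρ θ) * Real.cos θ, √(ρ θ) * Real.sin θ)) := by
  have hγc : Continuous γ := continuous_iff_continuousAt.2 fun t => (hγ t).continuousAt
  set x : ℝ → ℝ := fun t => (γ t).1 with hx
  set y : ℝ → ℝ := fun t => (γ t).2 with hy
  set q : ℝ → ℝ := fun t => Q (x t) (y t) with hq
  set R : ℝ → ℝ := fun t => x t ^ 2 + y t ^ 2 with hRdef
  have hRm : ∀ t, R t ∈ Ioo lo hi := hm
  have hpos : ∀ t, 0 < R t := fun t => hlo.trans (hRm t).1
  have hxc : Continuous x := by fun_prop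
  have hyc : Continuous y := by fun_prop
  have hqc : Continuous q := hQ.comp (f := fun t => (x t, y t)) (by fun_prop)
  have hRc : Continuous R := by fun_prop
  have hxd : ∀ t, HasDerivAt x (-(y t)) t := fun t => (hγ t).fst
  have hyd : ∀ t, HasDerivAt y (x t + y t * q t) t := fun t => (hγ t).snd
  have hRd : ∀ t, HasDerivAt R (2 * y t ^ 2 * q t) t := by
    intro t
    refine (((hxd t).pow 2).add ((hyd t).pow 2)).congr_deriv ?_
    push_cast
    ring
  let ω : ℝ → ℝ := fun t => 1 + x t * y t / R t * q t
  have hωc : Continuous ω := by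
    have : Continuous (fun t => x t * y t / R t) :=
      (hxc.mul hyc).div hRc fun t => (hpos t).ne'
    fun_prop
  -- initial angle
  obtain ⟨θ0, hθx, hθy⟩ : ∃ θ0, x 0 = √(R 0) * Real.cos θ0 ∧ y 0 = √(R 0) * Real.sin θ0 := by
    refine ⟨Complex.arg ⟨x 0, y 0⟩, ?_, ?_⟩
    · have := Complex.norm_mul_cos_arg ⟨x 0, y 0⟩
      rw [Complex.norm_eq_sqrt_sq_add_sq] at this
      exact this.symm
    · have := Complex.norm_mul_sin_arg ⟨x 0, y 0⟩
      rw [Complex.norm_eq_sqrt_sq_add_sq] at this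
      exact this.symm
  let Θ : ℝ → ℝ := fun t => θ0 + ∫ s in (0 : ℝ)..t, ω s
  have hΘd : ∀ t, HasDerivAt Θ (ω t) t := fun t =>
    (hωc.integral_hasStrictDerivAt 0 t).hasDerivAt.const_add θ0
  have hΘ0 : Θ 0 = θ0 := by simp [Θ]
  -- rotated coordinates
  let u : ℝ → ℝ := fun t => x t * Real.cos (Θ t) + y t * Real.sin (Θ t)
  let v : ℝ → ℝ := fun t => y t * Real.cos (Θ t) - x t * Real.sin (Θ t)
  have hud : ∀ t, HasDerivAt u (y t ^ 2 * q t / R t * u t) t := by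
    intro t
    refine (((hxd t).mul (hΘd t).cos).add ((hyd t).mul (hΘd t).sin)).congr_deriv ?_
    have := (hpos t).ne'
    simp only [ω, u]
    field_simp
    simp only [hRdef]
    ring
  have hvd : ∀ t, HasDerivAt v (y t ^ 2 * q t / R t * v t) t := by
    intro t
    refine (((hyd t).mul (hΘd t).cos).sub ((hxd t).mul (hΘd t).sin)).congr_deriv ?_
    have := (hpos t).ne'
    simp only [ω, v]
    field_simp
    simp only [hRdef]
    ring
  have hsd : ∀ t, HasDerivAt (fun t => √(R t)) (y t ^ 2 * q t / R t * √(R t)) t := by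
    intro t
    refine ((hRd t).sqrt (hpos t).ne').congr_deriv ?_
    have h1 := Real.sqrt_pos.2 (hpos t)
    have h2 := Real.mul_self_sqrt (hpos t).le
    have h3 := (hpos t).ne'
    rw [div_mul_eq_mul_div, div_eq_div_iff (by positivity) h3]
    linear_combination (-2 * y t ^ 2 * q t) * h2
  have hcon : ∀ (k : ℝ → ℝ), (∀ t, HasDerivAt k (y t ^ 2 * q t / R t * k t) t) →
      ∀ t, k t / √(R t) = k 0 / √(R 0) := by
    intro k hk t
    have hdd : ∀ t, HasDerivAt (fun t => k t / √(R t)) 0 t := by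
      intro t
      refine ((hk t).div (hsd t) (Real.sqrt_pos.2 (hpos t)).ne').congr_deriv ?_
      rw [div_eq_zero_iff]
      left
      ring
    exact is_const_of_deriv_eq_zero (fun t => (hdd t).differentiableAt)
      (fun t => (hdd t).deriv) t 0
  have hu : ∀ t, u t = √(R t) := by
    intro t
    have h1 := hcon u hud t
    have h0 := Real.sqrt_pos.2 (hpos 0)
    have ht := Real.sqrt_pos.2 (hpos t)
    have e : u 0 = √(R 0) := by
      simp only [u, hΘ0]
      rw [hθx, hθy]
      linear_combination √(R 0) * Real.sin_sq_add_cos_sq θ0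
    rw [e, div_self h0.ne', div_eq_one_iff_eq ht.ne'] at h1
    exact h1
  have hv : ∀ t, v t = 0 := by
    intro t
    have h1 := hcon v hvd t
    have ht := Real.sqrt_pos.2 (hpos t)
    have e : v 0 = 0 := by
      simp only [v, hΘ0]
      rw [hθx, hθy]
      ring
    rw [e, zero_div, div_eq_zero_iff] at h1
    rcases h1 with h | h
    · exact h
    · exact absurd h ht.ne'
  have hxp : ∀ t, x t = √(R t) * Real.cos (Θ t) := by
    intro t
    have h1 := hu t
    have h2 := hv t
    simp only [u, v] at h1 h2
    linear_combination Real.cos (Θ t) * h1 - Real.sin (Θ t) * h2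
      - x t * Real.sin_sq_add_cos_sq (Θ t)
  have hyp : ∀ t, y t = √(R t) * Real.sin (Θ t) := by
    intro t
    have h1 := hu t
    have h2 := hv t
    simp only [u, v] at h1 h2
    linear_combination Real.sin (Θ t) * h1 + Real.cos (Θ t) * h2
      - y t * Real.sin_sq_add_cos_sq (Θ t)
  have hqG : ∀ t, q t = G (R t) (Θ t) := by
    intro t
    rw [← hG _ _ (hpos t), ← hxp, ← hyp]
  have hωG : ∀ t, ω t = 1 + Real.sin (2 * Θ t) / 2 * G (R t) (Θ t) := by
    intro t
    have h2 := Real.mul_self_sqrt (hpos t).le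
    have h3 := (hpos t).ne'
    have : x t * y t / R t = Real.sin (2 * Θ t) / 2 := by
      rw [div_eq_iff h3, Real.sin_two_mul, hxp, hyp]
      linear_combination (Real.cos (Θ t) * Real.sin (Θ t)) * h2
    simp only [ω, this, hqG]
  have hωb : ∀ t, 1 / 2 ≤ ω t := by
    intro t
    have h2 : |Real.sin (2 * Θ t) * G (R t) (Θ t)| ≤ 1 := by
      rw [abs_mul]
      exact mul_le_one₀ (Real.abs_sin_le_one _) (abs_nonneg _) (hG1 _ (hRm t) _)
    have h3 := abs_le.1 h2
    rw [hωG]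
    linarith
  obtain ⟨τ, hτ1, hτ2, hτd⟩ := kk_time_change Θ ω hΘd hωb
  -- periodicity
  obtain ⟨T, hT, hTp⟩ := hper
  have hωp : Function.Periodic ω T := by
    intro t
    simp only [ω, hRdef, hq, hx, hy, hTp]
  have hadd : ∀ t, Θ (t + T) = Θ t + (Θ T - Θ 0) := by
    intro t
    have hii : ∀ a b : ℝ, IntervalIntegrable ω MeasureTheory.volume a b :=
      fun a b => hωc.intervalIntegrable a b
    have e1 := intervalIntegral.integral_add_adjacent_intervals (hii 0 t) (hii t (t + T))
    have e2 := hωp.intervalIntegral_add_eq t 0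
    rw [zero_add] at e2
    simp only [Θ]
    rw [← e1, e2]
    simp
    ring
  have hCpos : 0 < Θ T - Θ 0 := by
    have hsm : StrictMono Θ := by
      apply strictMono_of_deriv_pos
      intro t
      rw [(hΘd t).deriv]
      linarith [hωb t]
    linarith [hsm hT]
  obtain ⟨n, hn0, hn⟩ : ∃ n : ℕ, 0 < n ∧ Θ T - Θ 0 = n * (2 * Real.pi) := by
    have hR0 : R T = R 0 := by
      have := hTp 0
      rw [zero_add] at this
      simp only [hRdef, hx, hy, this]
    have hs := (Real.sqrt_pos.2 (hpos 0)).ne'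
    have e1 : Real.cos (Θ T) = Real.cos (Θ 0) := by
      have := hTp 0
      rw [zero_add] at this
      have h1 := hxp T
      have h2 := hxp 0
      have h3 : x T = x 0 := by simp only [hx, this]
      rw [h3, h2, hR0] at h1
      exact (mul_left_cancel₀ hs h1).symm
    have e2 : Real.sin (Θ T) = Real.sin (Θ 0) := by
      have := hTp 0
      rw [zero_add] at this
      have h1 := hyp T
      have h2 := hyp 0
      have h3 : y T = y 0 := by simp only [hy, this]
      rw [h3, h2, hR0] at h1
      exact (mul_left_cancel₀ hs h1).symm
    have e3 : Real.cos (Θ T - Θ 0) = 1 := by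
      rw [Real.cos_sub, e1, e2]
      linarith [Real.sin_sq_add_cos_sq (Θ 0)]
    obtain ⟨k, hk⟩ := (Real.cos_eq_one_iff _).1 e3
    have hkpos : 0 < k := by
      by_contra hcon
      have : (k : ℝ) ≤ 0 := by exact_mod_cast not_lt.1 hcon
      have hp := Real.pi_pos
      nlinarith
    refine ⟨k.toNat, by omega, ?_⟩
    rw [← hk]
    have : ((k.toNat : ℤ) : ℝ) = k := by rw [Int.toNat_of_nonneg hkpos.le]
    rw [← this, Int.cast_natCast]
  have hτp : ∀ θ, τ (θ + n * (2 * Real.pi)) = τ θ + T := by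
    intro θ
    rw [← hτ2 (τ θ + T), hadd, hτ1, hn]
  refine ⟨fun θ => R (τ θ), fun θ => ?_, fun θ => hRm _, ⟨n, hn0, fun θ => ?_⟩, ?_⟩
  · have := (hRd (τ θ)).comp θ (hτd θ)
    refine this.congr_deriv ?_
    rw [hωG, hτ1, ← div_eq_mul_inv]
    congr 1
    have h2 := Real.mul_self_sqrt (hpos (τ θ)).le
    rw [hyp, hqG, hτ1, Real.cos_two_mul]
    have := Real.sin_sq_add_cos_sq θ
    have e : Real.cos θ ^ 2 = 1 - Real.sin θ ^ 2 := by linarith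
    rw [e]
    linear_combination (2 * Real.sin θ ^ 2 * G (R (τ θ)) θ) * h2
  · simp only [hτp, hRdef, hx, hy, hTp]
  · have hτs : Function.Surjective τ := fun t => ⟨Θ t, hτ2 t⟩
    rw [← hτs.range_comp γ]
    congr 1
    funext θ
    have h1 := hxp (τ θ)
    have h2 := hyp (τ θ)
    rw [hτ1] at h1 h2
    simp only [Function.comp]
    rw [← h1, ← h2]

open Set Metric

/-- Bounds and Lipschitz estimates on a compact convex set. -/
lemma kk_bd_lip (S : Set (ℝ × ℝ × ℝ × ℝ)) (hS : IsCompact S) (hc : Convex ℝ S)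
    (q : ℝ × ℝ × ℝ × ℝ → ℝ) (hq : ContDiffOn ℝ 1 q S) :
    ∃ M : ℝ, 0 ≤ M ∧ (∀ p ∈ S, |q p| ≤ M) ∧
      ∀ e R1 R2 x y : ℝ, (e, R1, x, y) ∈ S → (e, R2, x, y) ∈ S →
        |q (e, R1, x, y) - q (e, R2, x, y)| ≤ M * |R1 - R2| := by
  obtain ⟨L, hL⟩ := hq.exists_lipschitzOnWith one_ne_zero hc hS
  obtain ⟨M, hM⟩ := hS.exists_bound_of_continuousOn hq.continuousOn
  refine ⟨max (L : ℝ) (max M 0), ?_, fun p hp => ?_, fun e R1 R2 x y h1 h2 => ?_⟩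
  · exact le_max_of_le_right (le_max_right _ _)
  · exact (hM p hp).trans (le_max_of_le_right (le_max_left _ _))
  · have := hL.dist_le_mul _ h1 _ h2
    rw [Real.dist_eq] at this
    refine this.trans ?_
    have hd : dist (e, R1, x, y) (e, R2, x, y) = |R1 - R2| := by
      simp [Prod.dist_eq, Real.dist_eq]
    rw [hd]
    exact mul_le_mul_of_nonneg_right (le_max_left _ _) (abs_nonneg _)

lemma kk_E (F K : ℝ × ℝ × ℝ × ℝ → ℝ) (hF : ContDiff ℝ 1 F) (hK : ContDiff ℝ 1 K)
    (g : ℝ → ℝ) (hg : ContDiff ℝ 1 g) (V : ℝ → ℝ → ℝ → ℝ)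
    (hV0 : ∀ e R, V e R 0 = R) (hVper : ∀ e R θ, V e R (θ + 2 * Real.pi) = V e R θ)
    (hVd : ∀ (e : ℝ) (ρ : ℝ → ℝ) (θ : ℝ),
      1 + Real.sin (2 * θ) / 2 * (e * F (e, ρ θ, Real.cos (2 * θ), Real.sin (2 * θ))) ≠ 0 →
      HasDerivAt ρ (ρ θ * (1 - Real.cos (2 * θ)) *
        (e * F (e, ρ θ, Real.cos (2 * θ), Real.sin (2 * θ))) /
        (1 + Real.sin (2 * θ) / 2 * (e * F (e, ρ θ, Real.cos (2 * θ), Real.sin (2 * θ))))) θ →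
      HasDerivAt (fun t => V e (ρ t) t)
        (e ^ 3 * ((g (ρ θ) + e * K (e, ρ θ, Real.cos (2 * θ), Real.sin (2 * θ))) /
        (1 + Real.sin (2 * θ) / 2 * (e * F (e, ρ θ, Real.cos (2 * θ), Real.sin (2 * θ)))))) θ)
    (c lo hi : ℝ) (hlo : lo < c) (hhi : c < hi) (hg0 : g c = 0) (hg1 : deriv g c ≠ 0) :
    ∃ δ > 0, lo < c - δ ∧ c + δ < hi ∧ ∀ᶠ e in nhdsWithin (0 : ℝ) (Ioi 0),
      (∀ R ∈ Ioo (c - δ) (c + δ), ∀ θ : ℝ,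
        |e * F (e, R, Real.cos (2 * θ), Real.sin (2 * θ))| ≤ 1) ∧
      ∃ ρ : ℝ → ℝ, (∀ θ, HasDerivAt ρ (ρ θ * (1 - Real.cos (2 * θ)) *
        (e * F (e, ρ θ, Real.cos (2 * θ), Real.sin (2 * θ))) /
        (1 + Real.sin (2 * θ) / 2 * (e * F (e, ρ θ, Real.cos (2 * θ), Real.sin (2 * θ))))) θ) ∧
      (∀ θ, ρ θ ∈ Ioo (c - δ) (c + δ)) ∧
      (∀ θ, ρ (θ + 2 * Real.pi) = ρ θ) ∧
      ∀ ρ2 : ℝ → ℝ, (∀ θ, HasDerivAt ρ2 (ρ2 θ * (1 - Real.cos (2 * θ)) *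
        (e * F (e, ρ2 θ, Real.cos (2 * θ), Real.sin (2 * θ))) /
        (1 + Real.sin (2 * θ) / 2 * (e * F (e, ρ2 θ, Real.cos (2 * θ), Real.sin (2 * θ))))) θ) →
        (∀ θ, ρ2 θ ∈ Ioo (c - δ) (c + δ)) →
        ∀ n : ℕ, 0 < n → (∀ θ, ρ2 (θ + n * (2 * Real.pi)) = ρ2 θ) → ρ2 = ρ := by
  -- sign of the derivative
  obtain ⟨σ, hσ, hσg⟩ : ∃ σ : ℝ, σ * σ = 1 ∧ 0 < σ * deriv g c := by
    rcases lt_or_gt_of_ne hg1 with h | h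
    · exact ⟨-1, by norm_num, by linarith⟩
    · exact ⟨1, by norm_num, by linarith⟩
  have hσa : |σ| = 1 := by
    have : |σ| * |σ| = 1 := by rw [← abs_mul, hσ, abs_one]
    nlinarith [abs_nonneg σ]
  set m := σ * deriv g c / 2 with hm
  have hmpos : 0 < m := by positivity
  have hgd : Differentiable ℝ g := hg.differentiable one_ne_zero
  have hdc : Continuous (fun R => σ * deriv g R) :=
    continuous_const.mul (hg.continuous_deriv le_rfl)
  obtain ⟨δ, hδ, hδlo, hδhi, hδm⟩ : ∃ δ > 0, lo < c - δ ∧ c + δ < hi ∧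
      ∀ R ∈ Icc (c - δ) (c + δ), m < σ * deriv g R := by
    have hev : ∀ᶠ R in nhds c, m < σ * deriv g R :=
      hdc.continuousAt.eventually (lt_mem_nhds (by simp only [hm]; linarith))
    obtain ⟨d, hd, hd2⟩ := Metric.eventually_nhds_iff.1 hev
    refine ⟨min (d / 2) (min ((c - lo) / 2) ((hi - c) / 2)), ?_, ?_, ?_, ?_⟩
    · exact lt_min (by linarith) (lt_min (by linarith) (by linarith))
    · have := (min_le_right (d / 2) (min ((c - lo) / 2) ((hi - c) / 2))).trans (min_le_left _ _)
      linarith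
    · have := (min_le_right (d / 2) (min ((c - lo) / 2) ((hi - c) / 2))).trans (min_le_right _ _)
      linarith
    · intro R hR
      have := min_le_left (d / 2) (min ((c - lo) / 2) ((hi - c) / 2))
      apply hd2
      rw [Real.dist_eq, abs_lt]
      constructor <;> linarith [hR.1, hR.2]
  refine ⟨δ, hδ, hδlo, hδhi, ?_⟩
  set I := Icc (c - δ) (c + δ) with hI
  have hgm : ∀ R1 ∈ I, ∀ R2 ∈ I, R1 ≤ R2 → m * (R2 - R1) ≤ σ * g R2 - σ * g R1 := by
    intro R1 h1 R2 h2 h12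
    refine (convex_Icc (c - δ) (c + δ)).mul_sub_le_image_sub_of_le_deriv (f := fun R => σ * g R)
      (continuous_const.mul hg.continuous).continuousOn (hgd.const_mul σ).differentiableOn ?_ R1 h1 R2 h2 h12
    intro x hx
    rw [deriv_const_mul _ (hgd x)]
    exact (hδm x (interior_subset hx)).le
  -- bound for F
  set S1 : Set (ℝ × ℝ × ℝ × ℝ) := Icc 0 1 ×ˢ I ×ˢ Icc (-1) 1 ×ˢ Icc (-1) 1 with hS1
  have hS1c : IsCompact S1 := isCompact_Icc.prod (isCompact_Icc.prod
    (isCompact_Icc.prod isCompact_Icc))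
  obtain ⟨MF, hMF⟩ := hS1c.exists_bound_of_continuousOn hF.continuous.continuousOn
  set M0 := max MF 1 with hM0
  have hM0pos : 1 ≤ M0 := le_max_right _ _
  have hMF' : ∀ p ∈ S1, |F p| ≤ M0 := fun p hp => (hMF p hp).trans (le_max_left _ _)
  set S : Set (ℝ × ℝ × ℝ × ℝ) := Icc 0 (1 / M0) ×ˢ I ×ˢ Icc (-1) 1 ×ˢ Icc (-1) 1 with hS
  have hSc : IsCompact S := isCompact_Icc.prod (isCompact_Icc.prod
    (isCompact_Icc.prod isCompact_Icc))
  have hSconv : Convex ℝ S := (convex_Icc _ _).prod ((convex_Icc _ _).prod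
    ((convex_Icc _ _).prod (convex_Icc _ _)))
  have hSS : S ⊆ S1 := by
    refine prod_mono (Icc_subset_Icc le_rfl ?_) subset_rfl
    rw [div_le_one (by linarith)]
    exact hM0pos
  have heF : ∀ p ∈ S, |p.1 * F p| ≤ 1 := by
    intro p hp
    have h1 := hMF' p (hSS hp)
    have h2 : p.1 ∈ Icc 0 (1 / M0) := hp.1
    rw [abs_mul, abs_of_nonneg h2.1]
    calc p.1 * |F p| ≤ (1 / M0) * M0 :=
          mul_le_mul h2.2 h1 (abs_nonneg _) (by positivity)
      _ = 1 := by field_simp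
  let den : ℝ × ℝ × ℝ × ℝ → ℝ := fun p => 1 + p.2.2.2 / 2 * (p.1 * F p)
  have hden : ∀ p ∈ S, 1 / 2 ≤ den p := by
    intro p hp
    have h1 := heF p hp
    have h2 : p.2.2.2 ∈ Icc (-1 : ℝ) 1 := hp.2.2.2
    have h3 : |p.2.2.2 * (p.1 * F p)| ≤ 1 := by
      rw [abs_mul]
      exact mul_le_one₀ (abs_le.2 h2) (abs_nonneg _) h1
    have h4 := abs_le.1 h3
    simp only [den]
    linarith
  have hdenC : ContDiff ℝ 1 den := by fun_prop
  have hdne : ∀ p ∈ S, den p ≠ 0 := fun p hp => by linarith [hden p hp]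
  let q : ℝ × ℝ × ℝ × ℝ → ℝ := fun p => p.2.1 * (1 - p.2.2.1) * F p / den p
  let kt : ℝ × ℝ × ℝ × ℝ → ℝ := fun p => (K p - g p.2.1 * (p.2.2.2 / 2 * F p)) / den p
  have hq : ContDiffOn ℝ 1 q S :=
    ContDiffOn.div (ContDiff.contDiffOn (by fun_prop)) hdenC.contDiffOn hdne
  have hkt : ContDiffOn ℝ 1 kt S :=
    ContDiffOn.div (ContDiff.contDiffOn (by fun_prop)) hdenC.contDiffOn hdne
  obtain ⟨Mq, hMq0, hMqb, hMql⟩ := kk_bd_lip S hSc hSconv q hq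
  obtain ⟨Mk, hMk0, hMkb, hMkl⟩ := kk_bd_lip S hSc hSconv kt hkt
  -- smallness of e
  have e1 : ∀ᶠ e in nhdsWithin (0 : ℝ) (Ioi 0), e < 1 / M0 :=
    nhdsWithin_le_nhds (gt_mem_nhds (by positivity))
  have small : ∀ A b : ℝ, 0 < b → ∀ᶠ e in nhdsWithin (0 : ℝ) (Ioi 0), e * A < b := by
    intro A b hb
    have hc : ContinuousAt (fun e : ℝ => e * A) 0 := by fun_prop
    exact nhdsWithin_le_nhds (hc.eventually (gt_mem_nhds (by simpa using hb)))
  filter_upwards [e1, small Mq (δ / 32) (by linarith), small Mk m hmpos,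
    small Mk (m * (δ / 4)) (by positivity), self_mem_nhdsWithin] with e he1 he2 he3 he4 he0
  rw [mem_Ioi] at he0
  have hM01 : 1 / M0 ≤ 1 := by
    rw [div_le_one (by linarith)]
    exact hM0pos
  have hpS : ∀ R ∈ I, ∀ θ : ℝ, (e, R, Real.cos (2 * θ), Real.sin (2 * θ)) ∈ S := by
    intro R hR θ
    exact ⟨⟨he0.le, he1.le⟩, hR, ⟨Real.neg_one_le_cos _, Real.cos_le_one _⟩,
      ⟨Real.neg_one_le_sin _, Real.sin_le_one _⟩⟩
  refine ⟨fun R hR θ => heF _ (hpS R (Ioo_subset_Icc_self hR) θ), ?_⟩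
  let f : ℝ → ℝ → ℝ := fun θ R => R * (1 - Real.cos (2 * θ)) *
        (e * F (e, R, Real.cos (2 * θ), Real.sin (2 * θ))) /
        (1 + Real.sin (2 * θ) / 2 * (e * F (e, R, Real.cos (2 * θ), Real.sin (2 * θ))))
  have hfq : ∀ θ R, f θ R = e * q (e, R, Real.cos (2 * θ), Real.sin (2 * θ)) := by
    intro θ R
    simp only [f, q, den]
    ring
  let H : ℝ → ℝ → ℝ := fun R θ => σ * g R +
    e * (σ * kt (e, R, Real.cos (2 * θ), Real.sin (2 * θ)))
  have hHbd : ∀ R ∈ I, ∀ θ : ℝ,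
      |σ * kt (e, R, Real.cos (2 * θ), Real.sin (2 * θ))| ≤ Mk := by
    intro R hR θ
    rw [abs_mul, hσa, one_mul]
    exact hMkb _ (hpS R hR θ)
  have hcos : ∀ θ : ℝ, Real.cos (2 * (θ + 2 * Real.pi)) = Real.cos (2 * θ) := by
    intro θ
    rw [show 2 * (θ + 2 * Real.pi) = 2 * θ + 2 * Real.pi + 2 * Real.pi by ring,
      Real.cos_add_two_pi, Real.cos_add_two_pi]
  have hsin : ∀ θ : ℝ, Real.sin (2 * (θ + 2 * Real.pi)) = Real.sin (2 * θ) := by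
    intro θ
    rw [show 2 * (θ + 2 * Real.pi) = 2 * θ + 2 * Real.pi + 2 * Real.pi by ring,
      Real.sin_add_two_pi, Real.sin_add_two_pi]
  have hcI : c ∈ I := ⟨by linarith, by linarith⟩
  refine kk_scalar_periodic c δ (e * Mq) (Real.toNNReal (e * Mq)) hδ (by positivity)
    (by linarith) f ?_ ?_ ?_ ?_ (V e) H (hV0 e) (hVper e) (σ * e ^ 3) ?_ ?_ ?_ ?_ ?_
  · intro R hR
    simp only [hfq]
    refine continuous_const.mul ?_
    exact hq.continuousOn.comp_continuous (by fun_prop) (fun θ => hpS R hR θ)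
  · intro θ
    refine LipschitzOnWith.of_dist_le_mul fun R1 h1 R2 h2 => ?_
    rw [Real.coe_toNNReal _ (by positivity), Real.dist_eq, Real.dist_eq, hfq, hfq, ← mul_sub,
      abs_mul, abs_of_pos he0, mul_assoc]
    exact mul_le_mul_of_nonneg_left (hMql _ _ _ _ _ (hpS R1 h1 θ) (hpS R2 h2 θ)) he0.le
  · intro θ R hR
    rw [hfq, abs_mul, abs_of_pos he0]
    exact mul_le_mul_of_nonneg_left (hMqb _ (hpS R hR θ)) he0.le
  · intro θ R
    simp only [f, hcos, hsin]
  · have : σ ≠ 0 := by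
      rintro rfl
      simp at hσ
    positivity
  · intro ρ θ hρ hd
    have hne := hdne _ (hpS _ hρ θ)
    refine (hVd e ρ θ hne hd).congr_deriv ?_
    simp only [H, kt]
    have hx : (g (ρ θ) + e * K (e, ρ θ, Real.cos (2 * θ), Real.sin (2 * θ))) /
        den (e, ρ θ, Real.cos (2 * θ), Real.sin (2 * θ)) = g (ρ θ) + e *
        ((K (e, ρ θ, Real.cos (2 * θ), Real.sin (2 * θ)) - g (ρ θ) * (Real.sin (2 * θ) / 2 *
          F (e, ρ θ, Real.cos (2 * θ), Real.sin (2 * θ)))) /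
        den (e, ρ θ, Real.cos (2 * θ), Real.sin (2 * θ))) := by
      rw [div_eq_iff hne, add_mul, mul_assoc e, div_mul_cancel₀ _ hne]
      simp only [den]
      ring
    change e ^ 3 * ((g (ρ θ) + e * K (e, ρ θ, Real.cos (2 * θ), Real.sin (2 * θ))) /
        den (e, ρ θ, Real.cos (2 * θ), Real.sin (2 * θ))) = _
    rw [hx]
    linear_combination (-e ^ 3 * (g (ρ θ) + e *
        ((K (e, ρ θ, Real.cos (2 * θ), Real.sin (2 * θ)) - g (ρ θ) * (Real.sin (2 * θ) / 2 *
          F (e, ρ θ, Real.cos (2 * θ), Real.sin (2 * θ)))) /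
        den (e, ρ θ, Real.cos (2 * θ), Real.sin (2 * θ))))) * hσ
  · intro R hR θ
    have hRI : R ∈ I := ⟨hR.1, by linarith [hR.2]⟩
    have h1 := hgm R hRI c hcI (by linarith [hR.2])
    rw [hg0, mul_zero, zero_sub] at h1
    have h2 := abs_le.1 (hHbd R hRI θ)
    have h3 := mul_le_mul_of_nonneg_left h2.2 he0.le
    have h4 : m * (δ / 4) ≤ m * (c - R) := mul_le_mul_of_nonneg_left (by linarith [hR.2]) hmpos.le
    simp only [H]
    linarith
  · intro R hR θ
    have hRI : R ∈ I := ⟨by linarith [hR.1], hR.2⟩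
    have h1 := hgm c hcI R hRI (by linarith [hR.1])
    rw [hg0, mul_zero, sub_zero] at h1
    have h2 := abs_le.1 (hHbd R hRI θ)
    have h3 := mul_le_mul_of_nonneg_left h2.1 he0.le
    have h4 : m * (δ / 4) ≤ m * (R - c) := mul_le_mul_of_nonneg_left (by linarith [hR.1]) hmpos.le
    simp only [H]
    linarith
  · intro θ R1 h1 R2 h2 h12
    have a1 := hgm R1 h1 R2 h2 h12.le
    have a2 := hMkl _ _ _ _ _ (hpS R1 h1 θ) (hpS R2 h2 θ)
    rw [← one_mul |_ - kt _|, ← hσa, ← abs_mul, mul_sub, abs_sub_comm R1,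
      abs_of_pos (by linarith : 0 < R2 - R1)] at a2
    have a3 := mul_le_mul_of_nonneg_left (abs_le.1 a2).2 he0.le
    have a4 : e * Mk * (R2 - R1) < m * (R2 - R1) :=
      mul_lt_mul_of_pos_right he3 (by linarith)
    simp only [H]
    linarith

lemma kk_cycle (Q : ℝ → ℝ → ℝ) (hQ : Continuous (fun p : ℝ × ℝ => Q p.1 p.2))
    (G : ℝ → ℝ → ℝ)
    (hG : ∀ R θ, 0 < R → Q (√R * Real.cos θ) (√R * Real.sin θ) = G R θ)
    (lo hi : ℝ) (hlo : 0 < lo) (hG1 : ∀ R ∈ Ioo lo hi, ∀ θ, |G R θ| ≤ 1)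
    (hρ : ∃ ρ : ℝ → ℝ, (∀ θ, HasDerivAt ρ (ρ θ * (1 - Real.cos (2 * θ)) * G (ρ θ) θ /
        (1 + Real.sin (2 * θ) / 2 * G (ρ θ) θ)) θ) ∧
      (∀ θ, ρ θ ∈ Ioo lo hi) ∧ (∀ θ, ρ (θ + 2 * Real.pi) = ρ θ) ∧
      ∀ ρ2 : ℝ → ℝ, (∀ θ, HasDerivAt ρ2 (ρ2 θ * (1 - Real.cos (2 * θ)) * G (ρ2 θ) θ /
        (1 + Real.sin (2 * θ) / 2 * G (ρ2 θ) θ)) θ) →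
        (∀ θ, ρ2 θ ∈ Ioo lo hi) →
        ∀ n : ℕ, 0 < n → (∀ θ, ρ2 (θ + n * (2 * Real.pi)) = ρ2 θ) → ρ2 = ρ) :
    ∃ Γ : Set (ℝ × ℝ), Γ.Nonempty ∧ Γ ⊆ {p | p.1 ^ 2 + p.2 ^ 2 ∈ Ioo lo hi} ∧
      (∃ γ : ℝ → ℝ × ℝ, KkSol Q γ ∧ IsPeriodicCurve γ ∧ IsNonconstCurve γ ∧ range γ = Γ) ∧
      (∃ U : Set (ℝ × ℝ), IsOpen U ∧ Γ ⊆ U ∧ ∀ γ : ℝ → ℝ × ℝ, KkSol Q γ →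
        IsPeriodicCurve γ → IsNonconstCurve γ → range γ ⊆ U → range γ = Γ) := by
  obtain ⟨ρ, h1, h2, h3, h4⟩ := hρ
  have hsub : range (fun θ => (√(ρ θ) * Real.cos θ, √(ρ θ) * Real.sin θ)) ⊆
      {p : ℝ × ℝ | p.1 ^ 2 + p.2 ^ 2 ∈ Ioo lo hi} := by
    rintro _ ⟨θ, rfl⟩
    have e : (√(ρ θ) * Real.cos θ) ^ 2 + (√(ρ θ) * Real.sin θ) ^ 2 = ρ θ := by
      have a := Real.mul_self_sqrt (hlo.le.trans (h2 θ).1.le)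
      linear_combination a + √(ρ θ) ^ 2 * Real.sin_sq_add_cos_sq θ
    simp only [mem_setOf_eq, e]
    exact h2 θ
  refine ⟨_, range_nonempty _, hsub,
    kk_planar_of_scalar Q hQ G hG lo hi hlo hG1 ρ h1 h2 h3, _, ?_, hsub, ?_⟩
  · exact isOpen_Ioo.preimage (by fun_prop : Continuous (fun p : ℝ × ℝ => p.1 ^ 2 + p.2 ^ 2))
  · intro γ hγ hp _ hU
    obtain ⟨ρ2, r1, r2, ⟨n, hn, r3⟩, r4⟩ := kk_scalar_of_planar Q hQ G hG lo hi hlo hG1 γ hγ hp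
      (fun t => hU (mem_range_self t))
    rw [r4, h4 ρ2 r1 r2 n hn r3]

open Set Metric

/-- `∑ W_j(R) c^j`. -/
noncomputable def kkev {n : ℕ} (W : Fin n → Polynomial ℝ) (R c : ℝ) : ℝ :=
  ∑ j, (W j).eval R * c ^ (j : ℕ)

/-- The `c`-derivative of `kkev`. -/
noncomputable def kkevc {n : ℕ} (W : Fin n → Polynomial ℝ) (R c : ℝ) : ℝ :=
  ∑ j, (W j).eval R * ((j : ℕ) * c ^ ((j : ℕ) - 1))

/-- The `R`-derivative of `kkev`. -/
noncomputable def kkevR {n : ℕ} (W : Fin n → Polynomial ℝ) (R c : ℝ) : ℝ :=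
  ∑ j, (W j).derivative.eval R * c ^ (j : ℕ)

lemma kkev_hasDerivAt {n : ℕ} (W : Fin n → Polynomial ℝ) (ρ : ℝ → ℝ) (d θ : ℝ)
    (hρ : HasDerivAt ρ d θ) :
    HasDerivAt (fun t => kkev W (ρ t) (Real.cos (2 * t)))
      (kkevR W (ρ θ) (Real.cos (2 * θ)) * d +
        kkevc W (ρ θ) (Real.cos (2 * θ)) * (-2 * Real.sin (2 * θ))) θ := by
  have hc : HasDerivAt (fun t : ℝ => Real.cos (2 * t)) (-2 * Real.sin (2 * θ)) θ := by
    refine ((hasDerivAt_id θ).const_mul (2 : ℝ)).cos.congr_deriv ?_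
    simp only [id]
    ring
  unfold kkev
  refine (HasDerivAt.fun_sum (A := fun j t => (W j).eval (ρ t) * Real.cos (2 * t) ^ (j : ℕ))
    (A' := fun j => (W j).derivative.eval (ρ θ) * d * Real.cos (2 * θ) ^ (j : ℕ) +
      (W j).eval (ρ θ) * (((j : ℕ) : ℝ) * Real.cos (2 * θ) ^ ((j : ℕ) - 1) *
        (-2 * Real.sin (2 * θ)))) fun j _ => ?_).congr_deriv ?_
  · exact (((W j).hasDerivAt (ρ θ)).comp θ hρ).mul (hc.pow (j : ℕ))
  · unfold kkevR kkevc
    rw [Finset.sum_add_distrib, Finset.sum_mul, Finset.sum_mul]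
    congr 1 <;> refine Finset.sum_congr rfl fun j _ => by ring

lemma kk_eval_contDiff (P : Polynomial ℝ) :
    ContDiff ℝ 1 (fun p : ℝ × ℝ × ℝ × ℝ => P.eval p.2.1) := by
  have h : ContDiff ℝ 1 (fun x : ℝ => P.eval x) := by
    have h0 := P.contDiff_aeval (𝕜 := ℝ) 1
    simpa only [Polynomial.coe_aeval_eq_eval] using h0
  exact h.comp (by fun_prop : ContDiff ℝ 1 (fun p : ℝ × ℝ × ℝ × ℝ => p.2.1))

lemma kkev_contDiff {n : ℕ} (W : Fin n → Polynomial ℝ) :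
    ContDiff ℝ 1 (fun p : ℝ × ℝ × ℝ × ℝ => kkev W p.2.1 p.2.2.1) := by
  unfold kkev
  exact ContDiff.sum fun j _ => (kk_eval_contDiff (W j)).mul (by fun_prop)

lemma kkevc_contDiff {n : ℕ} (W : Fin n → Polynomial ℝ) :
    ContDiff ℝ 1 (fun p : ℝ × ℝ × ℝ × ℝ => kkevc W p.2.1 p.2.2.1) := by
  unfold kkevc
  exact ContDiff.sum fun j _ => (kk_eval_contDiff (W j)).mul (by fun_prop)

lemma kkevR_contDiff {n : ℕ} (W : Fin n → Polynomial ℝ) :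
    ContDiff ℝ 1 (fun p : ℝ × ℝ × ℝ × ℝ => kkevR W p.2.1 p.2.2.1) := by
  unfold kkevR
  exact ContDiff.sum fun j _ => (kk_eval_contDiff (W j).derivative).mul (by fun_prop)

noncomputable def kkW1 (f k : Polynomial ℝ) : Fin 3 → Polynomial ℝ :=
  ![
    -(Polynomial.C (1 / 2) * Polynomial.X * f) + Polynomial.C (1 / 6) * Polynomial.X * k,
    Polynomial.C (1 / 2) * Polynomial.X * f - Polynomial.C (1 / 2) * Polynomial.X * k,
    Polynomial.C (1 / 3) * Polynomial.X * k]

noncomputable def kkW2 (f f1 k k1 : Polynomial ℝ) : Fin 7 → Polynomial ℝ :=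
  ![
    Polynomial.C (1 / 8) * Polynomial.X ^ 2 * f * f1
    - Polynomial.C (1 / 60) * Polynomial.X ^ 2 * f * k1
    - Polynomial.C (1 / 15) * Polynomial.X ^ 2 * f1 * k
    + Polynomial.C (1 / 72) * Polynomial.X ^ 2 * k * k1
    + Polynomial.C (1 / 2) * Polynomial.X * f ^ 2 - Polynomial.C (19 / 60) * Polynomial.X * f * k
    + Polynomial.C (4 / 45) * Polynomial.X * k ^ 2,
    -(Polynomial.C (1 / 4) * Polynomial.X ^ 2 * f * f1)
    + Polynomial.C (1 / 12) * Polynomial.X ^ 2 * f * k1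
    + Polynomial.C (1 / 4) * Polynomial.X ^ 2 * f1 * k
    - Polynomial.C (1 / 12) * Polynomial.X ^ 2 * k * k1
    - Polynomial.C (1 / 2) * Polynomial.X * f ^ 2 + Polynomial.C (5 / 6) * Polynomial.X * f * k
    - Polynomial.C (1 / 3) * Polynomial.X * k ^ 2,
    -(Polynomial.C (1 / 12) * Polynomial.X ^ 2 * f * k1)
    - Polynomial.C (1 / 4) * Polynomial.X ^ 2 * f1 * k
    + Polynomial.C (1 / 6) * Polynomial.X ^ 2 * k * k1
    - Polynomial.C (3 / 8) * Polynomial.X * f ^ 2 - Polynomial.C (1 / 12) * Polynomial.X * f * k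
    + Polynomial.C (7 / 24) * Polynomial.X * k ^ 2,
    Polynomial.C (1 / 4) * Polynomial.X ^ 2 * f * f1
    - Polynomial.C (1 / 12) * Polynomial.X ^ 2 * f * k1
    - Polynomial.C (1 / 12) * Polynomial.X ^ 2 * f1 * k
    - Polynomial.C (1 / 12) * Polynomial.X ^ 2 * k * k1
    + Polynomial.C (1 / 4) * Polynomial.X * f ^ 2 - Polynomial.C (5 / 6) * Polynomial.X * f * k
    + Polynomial.C (1 / 4) * Polynomial.X * k ^ 2,
    -(Polynomial.C (1 / 8) * Polynomial.X ^ 2 * f * f1)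
    + Polynomial.C (1 / 6) * Polynomial.X ^ 2 * f * k1
    + Polynomial.C (1 / 4) * Polynomial.X ^ 2 * f1 * k
    - Polynomial.C (1 / 8) * Polynomial.X ^ 2 * k * k1
    + Polynomial.C (1 / 8) * Polynomial.X * f ^ 2 + Polynomial.C (1 / 6) * Polynomial.X * f * k
    - Polynomial.C (3 / 8) * Polynomial.X * k ^ 2,
    -(Polynomial.C (1 / 15) * Polynomial.X ^ 2 * f * k1)
    - Polynomial.C (1 / 10) * Polynomial.X ^ 2 * f1 * k
    + Polynomial.C (1 / 6) * Polynomial.X ^ 2 * k * k1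
    + Polynomial.C (7 / 30) * Polynomial.X * f * k - Polynomial.C (1 / 30) * Polynomial.X * k ^ 2,
    -(Polynomial.C (1 / 18) * Polynomial.X ^ 2 * k * k1)
    + Polynomial.C (1 / 9) * Polynomial.X * k ^ 2]

set_option maxHeartbeats 1000000 in
noncomputable def kkW3_0 (f f1 f2 k k1 k2 φ : Polynomial ℝ) : Polynomial ℝ :=
    -(Polynomial.C (1 / 48) * Polynomial.X ^ 3 * f ^ 2 * f2)
    - Polynomial.C (1 / 42) * Polynomial.X ^ 3 * f ^ 2 * k2
    - Polynomial.C (1 / 48) * Polynomial.X ^ 3 * f * f1 ^ 2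
    + Polynomial.C (9 / 280) * Polynomial.X ^ 3 * f * f1 * k1
    + Polynomial.C (5 / 112) * Polynomial.X ^ 3 * f * f2 * k
    + Polynomial.C (1 / 80) * Polynomial.X ^ 3 * f * k * k2
    - Polynomial.C (11 / 720) * Polynomial.X ^ 3 * f * k1 ^ 2
    - Polynomial.C (19 / 1680) * Polynomial.X ^ 3 * f1 ^ 2 * k
    + Polynomial.C (1 / 120) * Polynomial.X ^ 3 * f1 * k * k1
    - Polynomial.C (7 / 360) * Polynomial.X ^ 3 * f2 * k ^ 2
    + Polynomial.C (1 / 1296) * Polynomial.X ^ 3 * k ^ 2 * k2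
    + Polynomial.C (1 / 1296) * Polynomial.X ^ 3 * k * k1 ^ 2
    - Polynomial.C (53 / 120) * Polynomial.X ^ 2 * f ^ 2 * f1
    + Polynomial.C (27 / 280) * Polynomial.X ^ 2 * f ^ 2 * k1
    + Polynomial.C (31 / 84) * Polynomial.X ^ 2 * f * f1 * k
    - Polynomial.C (103 / 630) * Polynomial.X ^ 2 * f * k * k1
    - Polynomial.C (169 / 2520) * Polynomial.X ^ 2 * f1 * k ^ 2
    + Polynomial.C (1093 / 22680) * Polynomial.X ^ 2 * k ^ 2 * k1
    - Polynomial.C (7 / 20) * Polynomial.X * f ^ 3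
    + Polynomial.C (17 / 56) * Polynomial.X * f ^ 2 * k
    - Polynomial.C (103 / 840) * Polynomial.X * f * k ^ 2
    + Polynomial.C (23 / 2835) * Polynomial.X * k ^ 3 + Polynomial.C (1 / 2) * Polynomial.X * φ

set_option maxHeartbeats 1000000 in
noncomputable def kkW3_1 (f f1 f2 k k1 k2 : Polynomial ℝ) : Polynomial ℝ :=
    Polynomial.C (1 / 16) * Polynomial.X ^ 3 * f ^ 2 * f2
    + Polynomial.C (7 / 960) * Polynomial.X ^ 3 * f ^ 2 * k2
    + Polynomial.C (1 / 16) * Polynomial.X ^ 3 * f * f1 ^ 2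
    - Polynomial.C (11 / 192) * Polynomial.X ^ 3 * f * f1 * k1
    - Polynomial.C (107 / 960) * Polynomial.X ^ 3 * f * f2 * k
    + Polynomial.C (71 / 11520) * Polynomial.X ^ 3 * f * k * k2
    + Polynomial.C (37 / 2304) * Polynomial.X ^ 3 * f * k1 ^ 2
    - Polynomial.C (3 / 64) * Polynomial.X ^ 3 * f1 ^ 2 * k
    + Polynomial.C (25 / 768) * Polynomial.X ^ 3 * f1 * k * k1
    + Polynomial.C (163 / 3840) * Polynomial.X ^ 3 * f2 * k ^ 2
    - Polynomial.C (1 / 144) * Polynomial.X ^ 3 * k ^ 2 * k2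
    - Polynomial.C (1 / 144) * Polynomial.X ^ 3 * k * k1 ^ 2
    + Polynomial.C (51 / 64) * Polynomial.X ^ 2 * f ^ 2 * f1
    - Polynomial.C (119 / 480) * Polynomial.X ^ 2 * f ^ 2 * k1
    - Polynomial.C (367 / 320) * Polynomial.X ^ 2 * f * f1 * k
    + Polynomial.C (973 / 2304) * Polynomial.X ^ 2 * f * k * k1
    + Polynomial.C (7 / 20) * Polynomial.X ^ 2 * f1 * k ^ 2
    - Polynomial.C (1859 / 11520) * Polynomial.X ^ 2 * k ^ 2 * k1
    + Polynomial.C (13 / 32) * Polynomial.X * f ^ 3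
    - Polynomial.C (157 / 160) * Polynomial.X * f ^ 2 * k
    + Polynomial.C (4123 / 5760) * Polynomial.X * f * k ^ 2
    - Polynomial.C (1081 / 5760) * Polynomial.X * k ^ 3

set_option maxHeartbeats 1000000 in
noncomputable def kkW3_2 (f f1 f2 k k1 k2 : Polynomial ℝ) : Polynomial ℝ :=
    -(Polynomial.C (1 / 24) * Polynomial.X ^ 3 * f ^ 2 * f2)
    + Polynomial.C (1 / 210) * Polynomial.X ^ 3 * f ^ 2 * k2
    - Polynomial.C (1 / 24) * Polynomial.X ^ 3 * f * f1 ^ 2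
    + Polynomial.C (11 / 140) * Polynomial.X ^ 3 * f * f1 * k1
    + Polynomial.C (17 / 105) * Polynomial.X ^ 3 * f * f2 * k
    - Polynomial.C (13 / 360) * Polynomial.X ^ 3 * f * k * k2
    - Polynomial.C (1 / 40) * Polynomial.X ^ 3 * f * k1 ^ 2
    + Polynomial.C (37 / 420) * Polynomial.X ^ 3 * f1 ^ 2 * k
    - Polynomial.C (1 / 10) * Polynomial.X ^ 3 * f1 * k * k1
    - Polynomial.C (4 / 45) * Polynomial.X ^ 3 * f2 * k ^ 2
    + Polynomial.C (2 / 81) * Polynomial.X ^ 3 * k ^ 2 * k2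
    + Polynomial.C (2 / 81) * Polynomial.X ^ 3 * k * k1 ^ 2
    - Polynomial.C (19 / 120) * Polynomial.X ^ 2 * f ^ 2 * f1
    + Polynomial.C (59 / 280) * Polynomial.X ^ 2 * f ^ 2 * k1
    + Polynomial.C (153 / 140) * Polynomial.X ^ 2 * f * f1 * k
    - Polynomial.C (277 / 420) * Polynomial.X ^ 2 * f * k * k1
    - Polynomial.C (1523 / 2520) * Polynomial.X ^ 2 * f1 * k ^ 2
    + Polynomial.C (8327 / 22680) * Polynomial.X ^ 2 * k ^ 2 * k1
    + Polynomial.C (21 / 80) * Polynomial.X * f ^ 3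
    - Polynomial.C (53 / 1680) * Polynomial.X * f ^ 2 * k
    - Polynomial.C (2171 / 5040) * Polynomial.X * f * k ^ 2
    + Polynomial.C (11587 / 45360) * Polynomial.X * k ^ 3

set_option maxHeartbeats 1000000 in
noncomputable def kkW3_3 (f f1 f2 k k1 k2 : Polynomial ℝ) : Polynomial ℝ :=
    -(Polynomial.C (1 / 24) * Polynomial.X ^ 3 * f ^ 2 * f2)
    + Polynomial.C (1 / 96) * Polynomial.X ^ 3 * f ^ 2 * k2
    - Polynomial.C (1 / 24) * Polynomial.X ^ 3 * f * f1 ^ 2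
    - Polynomial.C (1 / 96) * Polynomial.X ^ 3 * f * f1 * k1
    - Polynomial.C (5 / 96) * Polynomial.X ^ 3 * f * f2 * k
    + Polynomial.C (41 / 1152) * Polynomial.X ^ 3 * f * k * k2
    + Polynomial.C (23 / 1152) * Polynomial.X ^ 3 * f * k1 ^ 2
    - Polynomial.C (1 / 32) * Polynomial.X ^ 3 * f1 ^ 2 * k
    + Polynomial.C (121 / 1152) * Polynomial.X ^ 3 * f1 * k * k1
    + Polynomial.C (103 / 1152) * Polynomial.X ^ 3 * f2 * k ^ 2
    - Polynomial.C (1 / 24) * Polynomial.X ^ 3 * k ^ 2 * k2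
    - Polynomial.C (1 / 24) * Polynomial.X ^ 3 * k * k1 ^ 2
    - Polynomial.C (41 / 96) * Polynomial.X ^ 2 * f ^ 2 * f1
    + Polynomial.C (3 / 16) * Polynomial.X ^ 2 * f ^ 2 * k1
    + Polynomial.C (29 / 96) * Polynomial.X ^ 2 * f * f1 * k
    + Polynomial.C (175 / 1152) * Polynomial.X ^ 2 * f * k * k1
    + Polynomial.C (17 / 72) * Polynomial.X ^ 2 * f1 * k ^ 2
    - Polynomial.C (127 / 384) * Polynomial.X ^ 2 * k ^ 2 * k1
    + Polynomial.C (17 / 24) * Polynomial.X * f ^ 2 * k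
    - Polynomial.C (415 / 576) * Polynomial.X * f * k ^ 2
    + Polynomial.C (53 / 576) * Polynomial.X * k ^ 3

set_option maxHeartbeats 1000000 in
noncomputable def kkW3_4 (f f1 f2 k k1 k2 : Polynomial ℝ) : Polynomial ℝ :=
    Polynomial.C (1 / 16) * Polynomial.X ^ 3 * f ^ 2 * f2
    - Polynomial.C (4 / 105) * Polynomial.X ^ 3 * f ^ 2 * k2
    + Polynomial.C (1 / 16) * Polynomial.X ^ 3 * f * f1 ^ 2
    - Polynomial.C (73 / 840) * Polynomial.X ^ 3 * f * f1 * k1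
    - Polynomial.C (181 / 1680) * Polynomial.X ^ 3 * f * f2 * k
    + Polynomial.C (7 / 240) * Polynomial.X ^ 3 * f * k * k2
    + Polynomial.C (1 / 80) * Polynomial.X ^ 3 * f * k1 ^ 2
    - Polynomial.C (33 / 560) * Polynomial.X ^ 3 * f1 ^ 2 * k
    + Polynomial.C (1 / 120) * Polynomial.X ^ 3 * f1 * k * k1
    - Polynomial.C (1 / 120) * Polynomial.X ^ 3 * f2 * k ^ 2
    + Polynomial.C (11 / 432) * Polynomial.X ^ 3 * k ^ 2 * k2
    + Polynomial.C (11 / 432) * Polynomial.X ^ 3 * k * k1 ^ 2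
    + Polynomial.C (1 / 10) * Polynomial.X ^ 2 * f ^ 2 * f1
    - Polynomial.C (113 / 420) * Polynomial.X ^ 2 * f ^ 2 * k1
    - Polynomial.C (26 / 35) * Polynomial.X ^ 2 * f * f1 * k
    + Polynomial.C (83 / 140) * Polynomial.X ^ 2 * f * k * k1
    + Polynomial.C (5 / 14) * Polynomial.X ^ 2 * f1 * k ^ 2
    - Polynomial.C (187 / 1890) * Polynomial.X ^ 2 * k ^ 2 * k1
    - Polynomial.C (13 / 80) * Polynomial.X * f ^ 3
    + Polynomial.C (223 / 560) * Polynomial.X * f ^ 2 * k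
    + Polynomial.C (193 / 560) * Polynomial.X * f * k ^ 2
    - Polynomial.C (4763 / 15120) * Polynomial.X * k ^ 3

set_option maxHeartbeats 1000000 in
noncomputable def kkW3_5 (f f1 f2 k k1 k2 : Polynomial ℝ) : Polynomial ℝ :=
    -(Polynomial.C (1 / 48) * Polynomial.X ^ 3 * f ^ 2 * f2)
    + Polynomial.C (1 / 30) * Polynomial.X ^ 3 * f ^ 2 * k2
    - Polynomial.C (1 / 48) * Polynomial.X ^ 3 * f * f1 ^ 2
    + Polynomial.C (1 / 12) * Polynomial.X ^ 3 * f * f1 * k1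
    + Polynomial.C (9 / 80) * Polynomial.X ^ 3 * f * f2 * k
    - Polynomial.C (121 / 1440) * Polynomial.X ^ 3 * f * k * k2
    - Polynomial.C (11 / 288) * Polynomial.X ^ 3 * f * k1 ^ 2
    + Polynomial.C (1 / 16) * Polynomial.X ^ 3 * f1 ^ 2 * k
    - Polynomial.C (31 / 288) * Polynomial.X ^ 3 * f1 * k * k1
    - Polynomial.C (89 / 1440) * Polynomial.X ^ 3 * f2 * k ^ 2
    + Polynomial.C (1 / 48) * Polynomial.X ^ 3 * k ^ 2 * k2
    + Polynomial.C (1 / 48) * Polynomial.X ^ 3 * k * k1 ^ 2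
    + Polynomial.C (1 / 12) * Polynomial.X ^ 2 * f ^ 2 * f1
    - Polynomial.C (1 / 120) * Polynomial.X ^ 2 * f ^ 2 * k1
    + Polynomial.C (1 / 40) * Polynomial.X ^ 2 * f * f1 * k
    - Polynomial.C (593 / 1440) * Polynomial.X ^ 2 * f * k * k1
    - Polynomial.C (103 / 360) * Polynomial.X ^ 2 * f1 * k ^ 2
    + Polynomial.C (173 / 480) * Polynomial.X ^ 2 * k ^ 2 * k1
    - Polynomial.C (1 / 16) * Polynomial.X * f ^ 3
    - Polynomial.C (73 / 240) * Polynomial.X * f ^ 2 * k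
    + Polynomial.C (11 / 18) * Polynomial.X * f * k ^ 2
    - Polynomial.C (17 / 360) * Polynomial.X * k ^ 3

set_option maxHeartbeats 1000000 in
noncomputable def kkW3_6 (f f1 f2 k k1 k2 : Polynomial ℝ) : Polynomial ℝ :=
    -(Polynomial.C (1 / 105) * Polynomial.X ^ 3 * f ^ 2 * k2)
    - Polynomial.C (1 / 42) * Polynomial.X ^ 3 * f * f1 * k1
    - Polynomial.C (9 / 280) * Polynomial.X ^ 3 * f * f2 * k
    + Polynomial.C (11 / 180) * Polynomial.X ^ 3 * f * k * k2
    + Polynomial.C (1 / 36) * Polynomial.X ^ 3 * f * k1 ^ 2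
    - Polynomial.C (1 / 56) * Polynomial.X ^ 3 * f1 ^ 2 * k
    + Polynomial.C (1 / 12) * Polynomial.X ^ 3 * f1 * k * k1
    + Polynomial.C (1 / 20) * Polynomial.X ^ 3 * f2 * k ^ 2
    - Polynomial.C (29 / 648) * Polynomial.X ^ 3 * k ^ 2 * k2
    - Polynomial.C (29 / 648) * Polynomial.X ^ 3 * k * k1 ^ 2
    + Polynomial.C (13 / 210) * Polynomial.X ^ 2 * f ^ 2 * k1
    + Polynomial.C (31 / 210) * Polynomial.X ^ 2 * f * f1 * k
    - Polynomial.C (13 / 126) * Polynomial.X ^ 2 * f * k * k1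
    - Polynomial.C (11 / 210) * Polynomial.X ^ 2 * f1 * k ^ 2
    - Polynomial.C (751 / 5670) * Polynomial.X ^ 2 * k ^ 2 * k1
    - Polynomial.C (157 / 840) * Polynomial.X * f ^ 2 * k
    - Polynomial.C (89 / 630) * Polynomial.X * f * k ^ 2
    + Polynomial.C (5213 / 22680) * Polynomial.X * k ^ 3

set_option maxHeartbeats 1000000 in
noncomputable def kkW3_7 (f f1 f2 k k1 k2 : Polynomial ℝ) : Polynomial ℝ :=
    -(Polynomial.C (11 / 720) * Polynomial.X ^ 3 * f * k * k2)
    - Polynomial.C (1 / 144) * Polynomial.X ^ 3 * f * k1 ^ 2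
    - Polynomial.C (1 / 48) * Polynomial.X ^ 3 * f1 * k * k1
    - Polynomial.C (1 / 80) * Polynomial.X ^ 3 * f2 * k ^ 2
    + Polynomial.C (1 / 36) * Polynomial.X ^ 3 * k ^ 2 * k2
    + Polynomial.C (1 / 36) * Polynomial.X ^ 3 * k * k1 ^ 2
    + Polynomial.C (79 / 720) * Polynomial.X ^ 2 * f * k * k1
    + Polynomial.C (1 / 15) * Polynomial.X ^ 2 * f1 * k ^ 2
    - Polynomial.C (61 / 720) * Polynomial.X ^ 2 * k ^ 2 * k1
    - Polynomial.C (67 / 360) * Polynomial.X * f * k ^ 2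
    + Polynomial.C (1 / 360) * Polynomial.X * k ^ 3

set_option maxHeartbeats 1000000 in
noncomputable def kkW3_8 (f f1 f2 k k1 k2 : Polynomial ℝ) : Polynomial ℝ :=
    -(Polynomial.C (1 / 162) * Polynomial.X ^ 3 * k ^ 2 * k2)
    - Polynomial.C (1 / 162) * Polynomial.X ^ 3 * k * k1 ^ 2
    + Polynomial.C (4 / 81) * Polynomial.X ^ 2 * k ^ 2 * k1
    - Polynomial.C (5 / 81) * Polynomial.X * k ^ 3

noncomputable def kkW3 (f f1 f2 k k1 k2 φ : Polynomial ℝ) : Fin 9 → Polynomial ℝ :=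
  ![kkW3_0 f f1 f2 k k1 k2 φ, kkW3_1 f f1 f2 k k1 k2,
    kkW3_2 f f1 f2 k k1 k2,
    kkW3_3 f f1 f2 k k1 k2,
    kkW3_4 f f1 f2 k k1 k2,
    kkW3_5 f f1 f2 k k1 k2,
    kkW3_6 f f1 f2 k k1 k2,
    kkW3_7 f f1 f2 k k1 k2,
    kkW3_8 f f1 f2 k k1 k2]

noncomputable def kkg (f f1 f2 k k1 k2 φ : Polynomial ℝ) : Polynomial ℝ :=
    -(Polynomial.C (1 / 32) * Polynomial.X ^ 3 * f ^ 2 * k2)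
    + Polynomial.C (1 / 32) * Polynomial.X ^ 3 * f * f1 * k1
    + Polynomial.C (1 / 32) * Polynomial.X ^ 3 * f * f2 * k
    + Polynomial.C (7 / 384) * Polynomial.X ^ 3 * f * k * k2
    - Polynomial.C (7 / 384) * Polynomial.X ^ 3 * f * k1 ^ 2
    - Polynomial.C (1 / 32) * Polynomial.X ^ 3 * f1 ^ 2 * k
    + Polynomial.C (7 / 384) * Polynomial.X ^ 3 * f1 * k * k1
    - Polynomial.C (7 / 384) * Polynomial.X ^ 3 * f2 * k ^ 2
    - Polynomial.C (3 / 32) * Polynomial.X ^ 2 * f ^ 2 * f1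
    + Polynomial.C (1 / 16) * Polynomial.X ^ 2 * f ^ 2 * k1
    + Polynomial.C (3 / 32) * Polynomial.X ^ 2 * f * f1 * k
    - Polynomial.C (47 / 384) * Polynomial.X ^ 2 * f * k * k1
    + Polynomial.C (13 / 384) * Polynomial.X ^ 2 * k ^ 2 * k1
    + Polynomial.C (3 / 16) * Polynomial.X * f ^ 3
    - Polynomial.C (3 / 16) * Polynomial.X * f ^ 2 * k
    + Polynomial.C (9 / 64) * Polynomial.X * f * k ^ 2
    - Polynomial.C (3 / 64) * Polynomial.X * k ^ 3 + Polynomial.X * φ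


lemma kk_id1 (f k : Polynomial ℝ) (R c : ℝ) :
    R * (1 - c) * (f.eval R * (1 + 2 * c) + k.eval R * (2 * c ^ 2 - 1)) +
      (2 * c * kkev (kkW1 f k) R c - 2 * (1 - c ^ 2) * kkevc (kkW1 f k) R c) = 0 := by
  simp [kkev, kkevc, kkW1, Fin.sum_univ_succ]
  ring

lemma kk_id2 (f k : Polynomial ℝ) (R c : ℝ) :
    kkevR (kkW1 f k) R c * (R * (1 - c) * (f.eval R * (1 + 2 * c) + k.eval R * (2 * c ^ 2 - 1))) +
      (2 * c * kkev (kkW1 f k) R c - 2 * (1 - c ^ 2) * kkevc (kkW1 f k) R c) *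
        ((f.eval R * (1 + 2 * c) + k.eval R * (2 * c ^ 2 - 1)) / 2) -
      2 * kkevc (kkW2 f f.derivative k k.derivative) R c = 0 := by
  simp [kkev, kkevc, kkevR, kkW1, kkW2, Fin.sum_univ_succ]
  ring

lemma kk_id20 (f f1 k k1 : Polynomial ℝ) (R : ℝ) : kkev (kkW2 f f1 k k1) R 1 = 0 := by
  simp [kkev, kkW2, Fin.sum_univ_succ]
  ring

set_option maxRecDepth 10000 in
set_option maxHeartbeats 4000000 in
lemma kk_id3 (f k φ : Polynomial ℝ) (R c : ℝ) :
    kkevR (kkW2 f f.derivative k k.derivative) R c *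
        (R * (1 - c) * (f.eval R * (1 + 2 * c) + k.eval R * (2 * c ^ 2 - 1))) +
      R * (1 - c) * φ.eval R -
      (1 - c ^ 2) * kkevc (kkW2 f f.derivative k k.derivative) R c *
        (f.eval R * (1 + 2 * c) + k.eval R * (2 * c ^ 2 - 1)) +
      (2 * c * kkev (kkW3 f f.derivative f.derivative.derivative k k.derivative
          k.derivative.derivative φ) R c
        - 2 * (1 - c ^ 2) * kkevc (kkW3 f f.derivative f.derivative.derivative k k.derivative
          k.derivative.derivative φ) R c) =
      (kkg f f.derivative f.derivative.derivative k k.derivative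
          k.derivative.derivative φ).eval R := by
  simp [Polynomial.derivative_pow, kkev, kkevc, kkevR, kkW2, kkW3, kkg, kkW3_0, kkW3_1, kkW3_2, kkW3_3, kkW3_4,
    kkW3_5, kkW3_6, kkW3_7, kkW3_8, Fin.sum_univ_succ]
  ring

open Set Metric

/-- The full angular function (divided by `ε`). -/
noncomputable def kkF (f k φ : Polynomial ℝ) (p : ℝ × ℝ × ℝ × ℝ) : ℝ :=
  f.eval p.2.1 * (1 + 2 * p.2.2.1) + k.eval p.2.1 * (2 * p.2.2.1 ^ 2 - 1) + p.1 ^ 2 * φ.eval p.2.1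

/-- The averaged function. -/
noncomputable def kkG (f k φ : Polynomial ℝ) : Polynomial ℝ :=
  kkg f f.derivative f.derivative.derivative k k.derivative k.derivative.derivative φ

lemma kk_smooth_K (F0 F1 X h B1 B2 B3 V1 V2 V3 : ℝ × ℝ × ℝ × ℝ → ℝ)
    (cF0 : ContDiff ℝ 1 F0) (cF1 : ContDiff ℝ 1 F1) (cX : ContDiff ℝ 1 X) (ch : ContDiff ℝ 1 h)
    (cB1 : ContDiff ℝ 1 B1) (cB2 : ContDiff ℝ 1 B2) (cB3 : ContDiff ℝ 1 B3)
    (cV1 : ContDiff ℝ 1 V1) (cV2 : ContDiff ℝ 1 V2) (cV3 : ContDiff ℝ 1 V3) :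
    ContDiff ℝ 1 (fun p : ℝ × ℝ × ℝ × ℝ =>
    V3 p * X p * F0 p + X p * V1 p * F1 p + h p * F0 p * B3 p + h p * F1 p * B1 p +
      p.1 * (V2 p * X p * F1 p + h p * F1 p * B2 p) +
      p.1 ^ 2 * (V3 p * X p * F1 p + h p * F1 p * B3 p)) := by
  fun_prop

lemma kk_gen (f k φ gP : Polynomial ℝ) (n1 n2 n3 : ℕ) (W1 : Fin n1 → Polynomial ℝ)
    (W2 : Fin n2 → Polynomial ℝ) (W3 : Fin n3 → Polynomial ℝ)
    (hid1 : ∀ R c : ℝ, R * (1 - c) * (f.eval R * (1 + 2 * c) + k.eval R * (2 * c ^ 2 - 1)) +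
      (2 * c * kkev W1 R c - 2 * (1 - c ^ 2) * kkevc W1 R c) = 0)
    (hid2 : ∀ R c : ℝ, kkevR W1 R c * (R * (1 - c) * (f.eval R * (1 + 2 * c) + k.eval R * (2 * c ^ 2 - 1))) +
      (2 * c * kkev W1 R c - 2 * (1 - c ^ 2) * kkevc W1 R c) *
        ((f.eval R * (1 + 2 * c) + k.eval R * (2 * c ^ 2 - 1)) / 2) - 2 * kkevc W2 R c = 0)
    (hid20 : ∀ R : ℝ, kkev W2 R 1 = 0)
    (hid3 : ∀ R c : ℝ, kkevR W2 R c * (R * (1 - c) * (f.eval R * (1 + 2 * c) + k.eval R * (2 * c ^ 2 - 1))) + R * (1 - c) * φ.eval R -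
      (1 - c ^ 2) * kkevc W2 R c * (f.eval R * (1 + 2 * c) + k.eval R * (2 * c ^ 2 - 1)) +
      (2 * c * kkev W3 R c - 2 * (1 - c ^ 2) * kkevc W3 R c) = gP.eval R)
    (c lo hi : ℝ) (hlo : lo < c) (hhi : c < hi)
    (hg0 : gP.eval c = 0) (hg1 : gP.derivative.eval c ≠ 0) :
    ∃ δ > 0, lo < c - δ ∧ c + δ < hi ∧ ∀ᶠ e in nhdsWithin (0 : ℝ) (Ioi 0),
      (∀ R ∈ Ioo (c - δ) (c + δ), ∀ θ : ℝ,
        |e * kkF f k φ (e, R, Real.cos (2 * θ), Real.sin (2 * θ))| ≤ 1) ∧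
      ∃ ρ : ℝ → ℝ, (∀ θ, HasDerivAt ρ (ρ θ * (1 - Real.cos (2 * θ)) *
        (e * kkF f k φ (e, ρ θ, Real.cos (2 * θ), Real.sin (2 * θ))) /
        (1 + Real.sin (2 * θ) / 2 *
          (e * kkF f k φ (e, ρ θ, Real.cos (2 * θ), Real.sin (2 * θ))))) θ) ∧
      (∀ θ, ρ θ ∈ Ioo (c - δ) (c + δ)) ∧
      (∀ θ, ρ (θ + 2 * Real.pi) = ρ θ) ∧
      ∀ ρ2 : ℝ → ℝ, (∀ θ, HasDerivAt ρ2 (ρ2 θ * (1 - Real.cos (2 * θ)) *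
        (e * kkF f k φ (e, ρ2 θ, Real.cos (2 * θ), Real.sin (2 * θ))) /
        (1 + Real.sin (2 * θ) / 2 *
          (e * kkF f k φ (e, ρ2 θ, Real.cos (2 * θ), Real.sin (2 * θ))))) θ) →
        (∀ θ, ρ2 θ ∈ Ioo (c - δ) (c + δ)) →
        ∀ n : ℕ, 0 < n → (∀ θ, ρ2 (θ + n * (2 * Real.pi)) = ρ2 θ) → ρ2 = ρ := by
  let F0 : ℝ × ℝ × ℝ × ℝ → ℝ := fun p =>
    f.eval p.2.1 * (1 + 2 * p.2.2.1) + k.eval p.2.1 * (2 * p.2.2.1 ^ 2 - 1)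
  let F1 : ℝ × ℝ × ℝ × ℝ → ℝ := fun p => φ.eval p.2.1
  let X : ℝ × ℝ × ℝ × ℝ → ℝ := fun p => p.2.1 * (1 - p.2.2.1)
  let h : ℝ × ℝ × ℝ × ℝ → ℝ := fun p => p.2.2.2 / 2
  let B1 : ℝ × ℝ × ℝ × ℝ → ℝ := fun p => 2 * p.2.2.1 * kkev W1 p.2.1 p.2.2.1 -
    2 * p.2.2.2 ^ 2 * kkevc W1 p.2.1 p.2.2.1
  let B2 : ℝ × ℝ × ℝ × ℝ → ℝ := fun p => -2 * p.2.2.2 * kkevc W2 p.2.1 p.2.2.1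
  let B3 : ℝ × ℝ × ℝ × ℝ → ℝ := fun p => 2 * p.2.2.1 * kkev W3 p.2.1 p.2.2.1 -
    2 * p.2.2.2 ^ 2 * kkevc W3 p.2.1 p.2.2.1
  let V1 : ℝ × ℝ × ℝ × ℝ → ℝ := fun p => p.2.2.2 * kkevR W1 p.2.1 p.2.2.1
  let V2 : ℝ × ℝ × ℝ × ℝ → ℝ := fun p => kkevR W2 p.2.1 p.2.2.1
  let V3 : ℝ × ℝ × ℝ × ℝ → ℝ := fun p => p.2.2.2 * kkevR W3 p.2.1 p.2.2.1
  have hc : ContDiff ℝ 1 (fun p : ℝ × ℝ × ℝ × ℝ => p.2.2.1) := by fun_prop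
  have hs : ContDiff ℝ 1 (fun p : ℝ × ℝ × ℝ × ℝ => p.2.2.2) := by fun_prop
  have hR : ContDiff ℝ 1 (fun p : ℝ × ℝ × ℝ × ℝ => p.2.1) := by fun_prop
  have he : ContDiff ℝ 1 (fun p : ℝ × ℝ × ℝ × ℝ => p.1) := by fun_prop
  have cF1 : ContDiff ℝ 1 F1 := kk_eval_contDiff φ
  have cF0 : ContDiff ℝ 1 F0 :=
    ((kk_eval_contDiff f).mul (contDiff_const.add (contDiff_const.mul hc))).add
      ((kk_eval_contDiff k).mul ((contDiff_const.mul (hc.pow 2)).sub contDiff_const))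
  have cF : ContDiff ℝ 1 (kkF f k φ) := cF0.add ((he.pow 2).mul cF1)
  have cX : ContDiff ℝ 1 X := hR.mul (contDiff_const.sub hc)
  have ch : ContDiff ℝ 1 h := hs.div_const 2
  have cB1 : ContDiff ℝ 1 B1 := ((contDiff_const.mul hc).mul (kkev_contDiff W1)).sub
    ((contDiff_const.mul (hs.pow 2)).mul (kkevc_contDiff W1))
  have cB2 : ContDiff ℝ 1 B2 := (contDiff_const.mul hs).mul (kkevc_contDiff W2)
  have cB3 : ContDiff ℝ 1 B3 := ((contDiff_const.mul hc).mul (kkev_contDiff W3)).sub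
    ((contDiff_const.mul (hs.pow 2)).mul (kkevc_contDiff W3))
  have cV1 : ContDiff ℝ 1 V1 := hs.mul (kkevR_contDiff W1)
  have cV2 : ContDiff ℝ 1 V2 := kkevR_contDiff W2
  have cV3 : ContDiff ℝ 1 V3 := hs.mul (kkevR_contDiff W3)
  let K : ℝ × ℝ × ℝ × ℝ → ℝ := fun p =>
    V3 p * X p * F0 p + X p * V1 p * F1 p + h p * F0 p * B3 p + h p * F1 p * B1 p +
      p.1 * (V2 p * X p * F1 p + h p * F1 p * B2 p) +
      p.1 ^ 2 * (V3 p * X p * F1 p + h p * F1 p * B3 p)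
  let V : ℝ → ℝ → ℝ → ℝ := fun e R θ => R + e * (Real.sin (2 * θ) * kkev W1 R (Real.cos (2 * θ))) +
    e ^ 2 * kkev W2 R (Real.cos (2 * θ)) +
    e ^ 3 * (Real.sin (2 * θ) * kkev W3 R (Real.cos (2 * θ)))
  have hcos : ∀ θ : ℝ, Real.cos (2 * (θ + 2 * Real.pi)) = Real.cos (2 * θ) := by
    intro θ
    rw [show 2 * (θ + 2 * Real.pi) = 2 * θ + 2 * Real.pi + 2 * Real.pi by ring,
      Real.cos_add_two_pi, Real.cos_add_two_pi]
  have hsin : ∀ θ : ℝ, Real.sin (2 * (θ + 2 * Real.pi)) = Real.sin (2 * θ) := by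
    intro θ
    rw [show 2 * (θ + 2 * Real.pi) = 2 * θ + 2 * Real.pi + 2 * Real.pi by ring,
      Real.sin_add_two_pi, Real.sin_add_two_pi]
  have hgc : ContDiff ℝ 1 (fun R => gP.eval R) := by
    have h0 := gP.contDiff_aeval (𝕜 := ℝ) 1
    simpa only [Polynomial.coe_aeval_eq_eval] using h0
  refine kk_E (kkF f k φ) K ?_ ?_ (fun R => gP.eval R) hgc V ?_ ?_ ?_ c lo hi hlo hhi
    hg0 ?_
  · exact cF
  · exact kk_smooth_K F0 F1 X h B1 B2 B3 V1 V2 V3 cF0 cF1 cX ch cB1 cB2 cB3 cV1 cV2 cV3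
  · intro e R
    simp only [V, mul_zero, Real.sin_zero, Real.cos_zero, hid20]
    ring
  · intro e R θ
    simp only [V, hcos, hsin]
  · intro e ρ θ hne hd
    set d := ρ θ * (1 - Real.cos (2 * θ)) *
        (e * kkF f k φ (e, ρ θ, Real.cos (2 * θ), Real.sin (2 * θ))) /
        (1 + Real.sin (2 * θ) / 2 *
          (e * kkF f k φ (e, ρ θ, Real.cos (2 * θ), Real.sin (2 * θ)))) with hdd
    have hs : HasDerivAt (fun t : ℝ => Real.sin (2 * t)) (2 * Real.cos (2 * θ)) θ := by
      refine ((hasDerivAt_id θ).const_mul (2 : ℝ)).sin.congr_deriv ?_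
      simp only [id]
      ring
    have k1 := (hs.mul (kkev_hasDerivAt W1 ρ d θ hd)).const_mul e
    have k2 := (kkev_hasDerivAt W2 ρ d θ hd).const_mul (e ^ 2)
    have k3 := (hs.mul (kkev_hasDerivAt W3 ρ d θ hd)).const_mul (e ^ 3)
    refine (((hd.add k1).add k2).add k3).congr_deriv ?_
    have hdm : d * (1 + Real.sin (2 * θ) / 2 *
          (e * kkF f k φ (e, ρ θ, Real.cos (2 * θ), Real.sin (2 * θ)))) = ρ θ *
        (1 - Real.cos (2 * θ)) * (e * kkF f k φ (e, ρ θ, Real.cos (2 * θ), Real.sin (2 * θ))) :=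
      div_mul_cancel₀ _ hne
    clear_value d
    rw [← mul_div_assoc (e ^ 3), eq_div_iff hne]
    have i1 := hid1 (ρ θ) (Real.cos (2 * θ))
    have i2 := hid2 (ρ θ) (Real.cos (2 * θ))
    have i3 := hid3 (ρ θ) (Real.cos (2 * θ))
    have hsc : 1 - Real.cos (2 * θ) ^ 2 = Real.sin (2 * θ) ^ 2 := by
      linarith [Real.sin_sq_add_cos_sq (2 * θ)]
    rw [hsc] at i1 i2 i3
    simp only [K, F0, F1, X, h, B1, B2, B3, V1, V2, V3, kkF] at hdm ⊢
    generalize Real.sin (2 * θ) = s at *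
    generalize Real.cos (2 * θ) = c at *
    generalize ρ θ = R at *
    generalize kkev W1 R c = a1 at *
    generalize kkevR W1 R c = b1 at *
    generalize kkevc W1 R c = m1 at *
    generalize kkevR W2 R c = b2 at *
    generalize kkevc W2 R c = m2 at *
    generalize kkev W3 R c = a3 at *
    generalize kkevR W3 R c = b3 at *
    generalize kkevc W3 R c = m3 at *
    generalize gP.eval R = G at *
    generalize f.eval R = f at *
    generalize k.eval R = k at *
    generalize φ.eval R = φ at *
    linear_combination (1 + e * (s * b1) + e ^ 2 * b2 + e ^ 3 * (s * b3)) * hdm + e * i1 +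
      e ^ 2 * s * i2 + e ^ 3 * i3
  · rw [Polynomial.deriv]
    exact hg1

lemma kk_A (f k φ : Polynomial ℝ) (c lo hi : ℝ) (hlo : lo < c) (hhi : c < hi)
    (hg0 : (kkG f k φ).eval c = 0) (hg1 : (kkG f k φ).derivative.eval c ≠ 0) :
    ∃ δ > 0, lo < c - δ ∧ c + δ < hi ∧ ∀ᶠ e in nhdsWithin (0 : ℝ) (Ioi 0),
      (∀ R ∈ Ioo (c - δ) (c + δ), ∀ θ : ℝ,
        |e * kkF f k φ (e, R, Real.cos (2 * θ), Real.sin (2 * θ))| ≤ 1) ∧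
      ∃ ρ : ℝ → ℝ, (∀ θ, HasDerivAt ρ (ρ θ * (1 - Real.cos (2 * θ)) *
        (e * kkF f k φ (e, ρ θ, Real.cos (2 * θ), Real.sin (2 * θ))) /
        (1 + Real.sin (2 * θ) / 2 *
          (e * kkF f k φ (e, ρ θ, Real.cos (2 * θ), Real.sin (2 * θ))))) θ) ∧
      (∀ θ, ρ θ ∈ Ioo (c - δ) (c + δ)) ∧
      (∀ θ, ρ (θ + 2 * Real.pi) = ρ θ) ∧
      ∀ ρ2 : ℝ → ℝ, (∀ θ, HasDerivAt ρ2 (ρ2 θ * (1 - Real.cos (2 * θ)) *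
        (e * kkF f k φ (e, ρ2 θ, Real.cos (2 * θ), Real.sin (2 * θ))) /
        (1 + Real.sin (2 * θ) / 2 *
          (e * kkF f k φ (e, ρ2 θ, Real.cos (2 * θ), Real.sin (2 * θ))))) θ) →
        (∀ θ, ρ2 θ ∈ Ioo (c - δ) (c + δ)) →
        ∀ n : ℕ, 0 < n → (∀ θ, ρ2 (θ + n * (2 * Real.pi)) = ρ2 θ) → ρ2 = ρ := by
  exact kk_gen f k φ (kkG f k φ) _ _ _ _ _ _ (kk_id1 f k) (kk_id2 f k) (kk_id20 _ _ _ _)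
    (kk_id3 f k φ) c lo hi hlo hhi hg0 hg1

open Set Metric
set_option linter.unusedVariables false

/-- Coefficient of degree 3 of the reduced averaged function. -/
noncomputable def kks3 (a1 c2 a3 c3 : ℝ) : ℝ :=
  3 / 32 * a1 ^ 3

/-- Coefficient of degree 4 of the reduced averaged function. -/
noncomputable def kks4 (a1 c2 a3 c3 : ℝ) : ℝ :=
  -3 / 32 * a1 ^ 3 + 3 / 16 * a1 ^ 2

/-- Coefficient of degree 5 of the reduced averaged function. -/
noncomputable def kks5 (a1 c2 a3 c3 : ℝ) : ℝ :=
  -1 / 8 * a1 ^ 2 * c2 + 3 / 32 * a1 ^ 2 * a3 - 1 / 32 * a1 ^ 2 * c3 - 3 / 32 * a1 ^ 2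
    - 5 / 48 * a1 * c2 ^ 2 + 5 / 32 * a1 * c2 + 3 / 32 * a1

/-- Coefficient of degree 6 of the reduced averaged function. -/
noncomputable def kks6 (a1 c2 a3 c3 : ℝ) : ℝ :=
  1 / 8 * a1 ^ 2 * c2 + 3 / 32 * a1 ^ 2 * a3 - 1 / 32 * a1 ^ 2 * c3 - 3 / 32 * a1 ^ 2
    + 5 / 16 * a1 * c2 ^ 2 + 3 / 8 * a1 * c2 * a3 - 5 / 16 * a1 * c2 * c3 - 19 / 32 * a1 * c2
    + 1 / 8 * a1 * c3 + 3 / 32 * a1 + 1 / 48 * c2 ^ 3 - 5 / 48 * c2 ^ 2 + 1 / 8 * c2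

/-- Coefficient of degree 7 of the reduced averaged function. -/
noncomputable def kks7 (a1 c2 a3 c3 : ℝ) : ℝ :=
  -3 / 16 * a1 ^ 2 * a3 + 1 / 16 * a1 ^ 2 * c3 - 5 / 24 * a1 * c2 ^ 2 - 17 / 16 * a1 * c2 * a3
    + 313 / 384 * a1 * c2 * c3 + 7 / 16 * a1 * c2 - 3 / 32 * a1 * a3 ^ 2 + 3 / 8 * a1 * a3 * c3
    + 9 / 16 * a1 * a3 - 29 / 128 * a1 * c3 ^ 2 - 15 / 32 * a1 * c3 - 3 / 16 * a1
    - 29 / 384 * c2 ^ 3 - 9 / 64 * c2 ^ 2 * a3 + 37 / 384 * c2 ^ 2 * c3 + 127 / 384 * c2 ^ 2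
    + 13 / 32 * c2 * a3 - 113 / 384 * c2 * c3 - 13 / 32 * c2 - 3 / 32 * a3 + 1 / 8 * c3
    + 3 / 32

/-- Coefficient of degree 8 of the reduced averaged function. -/
noncomputable def kks8 (a1 c2 a3 c3 : ℝ) : ℝ :=
  11 / 16 * a1 * c2 * a3 - 193 / 384 * a1 * c2 * c3 + 15 / 32 * a1 * a3 ^ 2
    - 1 / 1 * a1 * a3 * c3 - 9 / 16 * a1 * a3 + 69 / 128 * a1 * c3 ^ 2 + 11 / 32 * a1 * c3
    + 7 / 128 * c2 ^ 3 + 27 / 64 * c2 ^ 2 * a3 - 113 / 384 * c2 ^ 2 * c3 - 29 / 128 * c2 ^ 2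
    + 1 / 4 * c2 * a3 ^ 2 - 67 / 192 * c2 * a3 * c3 - 37 / 32 * c2 * a3
    + 25 / 192 * c2 * c3 ^ 2 + 313 / 384 * c2 * c3 + 9 / 32 * c2 - 3 / 16 * a3 ^ 2
    + 7 / 16 * a3 * c3 + 15 / 32 * a3 - 5 / 24 * c3 ^ 2 - 3 / 8 * c3 - 3 / 32

/-- Coefficient of degree 9 of the reduced averaged function. -/
noncomputable def kks9 (a1 c2 a3 c3 : ℝ) : ℝ :=
  -3 / 8 * a1 * a3 ^ 2 + 5 / 8 * a1 * a3 * c3 - 5 / 16 * a1 * c3 ^ 2 - 9 / 32 * c2 ^ 2 * a3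
    + 19 / 96 * c2 ^ 2 * c3 - 11 / 16 * c2 * a3 ^ 2 + 123 / 128 * c2 * a3 * c3
    + 3 / 4 * c2 * a3 - 139 / 384 * c2 * c3 ^ 2 - 25 / 48 * c2 * c3 - 3 / 32 * a3 ^ 3
    + 9 / 32 * a3 ^ 2 * c3 + 21 / 32 * a3 ^ 2 - 29 / 128 * a3 * c3 ^ 2 - 37 / 32 * a3 * c3
    - 3 / 8 * a3 + 7 / 128 * c3 ^ 3 + 25 / 48 * c3 ^ 2 + 1 / 4 * c3

/-- Coefficient of degree 10 of the reduced averaged function. -/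
noncomputable def kks10 (a1 c2 a3 c3 : ℝ) : ℝ :=
  7 / 16 * c2 * a3 ^ 2 - 235 / 384 * c2 * a3 * c3 + 89 / 384 * c2 * c3 ^ 2 + 9 / 32 * a3 ^ 3
    - 23 / 32 * a3 ^ 2 * c3 - 15 / 32 * a3 ^ 2 + 221 / 384 * a3 * c3 ^ 2 + 23 / 32 * a3 * c3
    - 55 / 384 * c3 ^ 3 - 5 / 16 * c3 ^ 2

/-- Coefficient of degree 11 of the reduced averaged function. -/
noncomputable def kks11 (a1 c2 a3 c3 : ℝ) : ℝ :=
  -3 / 16 * a3 ^ 3 + 7 / 16 * a3 ^ 2 * c3 - 67 / 192 * a3 * c3 ^ 2 + 17 / 192 * c3 ^ 3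

/-- The first-order radial part. -/
noncomputable def kkf (a1 a3 : ℝ) : Polynomial ℝ :=
  (1 - Polynomial.X) * (Polynomial.C a1 * Polynomial.X + Polynomial.X ^ 2 +
    Polynomial.C a3 * Polynomial.X ^ 3)

/-- The second harmonic part. -/
noncomputable def kkk (c2 c3 : ℝ) : Polynomial ℝ :=
  (1 - Polynomial.X) * (Polynomial.C c2 * Polynomial.X ^ 2 + Polynomial.C c3 * Polynomial.X ^ 3)

/-- The third-order radial part. -/
noncomputable def kkφ (g0 g1 g2 g3 : ℝ) : Polynomial ℝ :=
  (1 - Polynomial.X) * (Polynomial.C g0 + Polynomial.C g1 * Polynomial.X +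
    Polynomial.C g2 * Polynomial.X ^ 2 + Polynomial.C g3 * Polynomial.X ^ 3)

/-- The reduced averaged function. -/
noncomputable def kkS (a1 c2 a3 c3 g0 g1 g2 g3 : ℝ) : Polynomial ℝ :=
  Polynomial.C g0 + Polynomial.C g1 * Polynomial.X + Polynomial.C g2 * Polynomial.X ^ 2 +
    Polynomial.C (g3 + kks3 a1 c2 a3 c3) * Polynomial.X ^ 3 +
    Polynomial.C (kks4 a1 c2 a3 c3) * Polynomial.X ^ 4 +
    Polynomial.C (kks5 a1 c2 a3 c3) * Polynomial.X ^ 5 +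
    Polynomial.C (kks6 a1 c2 a3 c3) * Polynomial.X ^ 6 +
    Polynomial.C (kks7 a1 c2 a3 c3) * Polynomial.X ^ 7 +
    Polynomial.C (kks8 a1 c2 a3 c3) * Polynomial.X ^ 8 +
    Polynomial.C (kks9 a1 c2 a3 c3) * Polynomial.X ^ 9 +
    Polynomial.C (kks10 a1 c2 a3 c3) * Polynomial.X ^ 10 +
    Polynomial.C (kks11 a1 c2 a3 c3) * Polynomial.X ^ 11

lemma kkf_ev (a1 a3 R : ℝ) : (kkf a1 a3).eval R = (1 - R) * (a1 * R + R ^ 2 + a3 * R ^ 3) ∧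
    (kkf a1 a3).derivative.eval R =
      a1 + 2 * (1 - a1) * R + 3 * (a3 - 1) * R ^ 2 - 4 * a3 * R ^ 3 ∧
    (kkf a1 a3).derivative.derivative.eval R =
      2 * (1 - a1) + 6 * (a3 - 1) * R - 12 * a3 * R ^ 2 := by
  refine ⟨?_, ?_, ?_⟩ <;> simp [kkf] <;> ring

lemma kkk_ev (c2 c3 R : ℝ) : (kkk c2 c3).eval R = (1 - R) * (c2 * R ^ 2 + c3 * R ^ 3) ∧
    (kkk c2 c3).derivative.eval R =
      2 * c2 * R + 3 * (c3 - c2) * R ^ 2 - 4 * c3 * R ^ 3 ∧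
    (kkk c2 c3).derivative.derivative.eval R =
      2 * c2 + 6 * (c3 - c2) * R - 12 * c3 * R ^ 2 := by
  refine ⟨?_, ?_, ?_⟩ <;> simp [kkk] <;> ring

set_option maxHeartbeats 4000000 in
set_option maxRecDepth 10000 in
lemma kk_gS (a1 c2 a3 c3 g0 g1 g2 g3 : ℝ) :
    kkG (kkf a1 a3) (kkk c2 c3) (kkφ g0 g1 g2 g3) =
      Polynomial.X * (1 - Polynomial.X) * kkS a1 c2 a3 c3 g0 g1 g2 g3 := by
  apply Polynomial.funext
  intro R
  obtain ⟨f0, f1, f2⟩ := kkf_ev a1 a3 R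
  obtain ⟨k0, k1, k2⟩ := kkk_ev c2 c3 R
  have p0 : (kkφ g0 g1 g2 g3).eval R = (1 - R) * (g0 + g1 * R + g2 * R ^ 2 + g3 * R ^ 3) := by
    simp [kkφ]
  simp only [kkG, kkg, Polynomial.eval_add, Polynomial.eval_sub, Polynomial.eval_mul,
    Polynomial.eval_pow, Polynomial.eval_C, Polynomial.eval_X, Polynomial.eval_one,
    Polynomial.eval_neg, f0, f1, f2, k0, k1, k2, p0, kkS]
  simp only [kks3, kks4, kks5, kks6, kks7, kks8, kks9, kks10, kks11]
  ring

open Set Metric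

/-- Alternation of signs at `n + 1` decreasing points of `(0, ρ)`. -/
def KkAlt (ρ : ℝ) (n : ℕ) (S : ℝ → ℝ) : Prop :=
  ∃ x : ℕ → ℝ, (∀ i ≤ n, 0 < x i ∧ x i < ρ) ∧ (∀ i < n, x (i + 1) < x i) ∧
    ∀ i ≤ n, (-1 : ℝ) ^ i * S (x i) < 0

lemma kk_alt_zero (ρ : ℝ) (hρ : 0 < ρ) (S : ℝ → ℝ)
    (h : ∀ᶠ y in nhdsWithin (0 : ℝ) (Ioi 0), S y < 0) : KkAlt ρ 0 S := by
  have h2 : ∀ᶠ y in nhdsWithin (0 : ℝ) (Ioi 0), y ∈ Ioo 0 ρ := Ioo_mem_nhdsGT hρ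
  obtain ⟨y, h3, h4⟩ := (h.and h2).exists
  refine ⟨fun _ => y, fun i _ => h4, fun i hi => absurd hi (Nat.not_lt_zero i), ?_⟩
  intro i hi
  obtain rfl : i = 0 := Nat.le_zero.mp hi
  simpa using h3

lemma kk_alt_ext0 (ρ : ℝ) (n : ℕ) (S : ℝ → ℝ) (x : ℕ → ℝ)
    (h1 : ∀ i ≤ n, 0 < x i ∧ x i < ρ) (h2 : ∀ i < n, x (i + 1) < x i)
    (h3 : ∀ i ≤ n, (-1 : ℝ) ^ i * S (x i) < 0) (y : ℝ) (hy : 0 < y) (hyx : y < x n)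
    (hs : (-1 : ℝ) ^ (n + 1) * S y < 0) : KkAlt ρ (n + 1) S := by
  refine ⟨fun i => if i ≤ n then x i else y, ?_, ?_, ?_⟩
  · intro i hi
    by_cases h : i ≤ n
    · simpa [h] using h1 i h
    · simp only [h, if_false]
      exact ⟨hy, hyx.trans (h1 n le_rfl).2⟩
  · intro i hi
    have hi' : i ≤ n := by omega
    by_cases h : i + 1 ≤ n
    · simpa [h, hi'] using h2 i (by omega)
    · have : i = n := by omega
      subst this
      simpa using hyx
  · intro i hi
    by_cases h : i ≤ n
    · simpa [h] using h3 i h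
    · have : i = n + 1 := by omega
      subst this
      simpa using hs

lemma kk_alt_ext (ρ : ℝ) (n : ℕ) (S : ℝ → ℝ) (hA : KkAlt ρ n S)
    (h : ∀ᶠ y in nhdsWithin (0 : ℝ) (Ioi 0), (-1 : ℝ) ^ (n + 1) * S y < 0) :
    KkAlt ρ (n + 1) S := by
  obtain ⟨x, h1, h2, h3⟩ := hA
  have hb : ∀ᶠ y in nhdsWithin (0 : ℝ) (Ioi 0), y ∈ Ioo 0 (x n) :=
    Ioo_mem_nhdsGT (h1 n le_rfl).1
  obtain ⟨y, h4, h5⟩ := (h.and hb).exists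
  exact kk_alt_ext0 ρ n S x h1 h2 h3 y h5.1 h5.2 h4

lemma kk_alt_open (ρ : ℝ) (n : ℕ) (S : ℝ → ℝ → ℝ) (hA : KkAlt ρ n (S 0))
    (hS : ∀ y, Continuous (fun t => S t y)) :
    ∃ b > 0, ∀ᶠ t in nhdsWithin (0 : ℝ) (Ioi 0), KkAlt ρ n (S t) ∧
      ∀ y, 0 < y → y < b → (-1 : ℝ) ^ (n + 1) * S t y < 0 → KkAlt ρ (n + 1) (S t) := by
  obtain ⟨x, h1, h2, h3⟩ := hA
  refine ⟨x n, (h1 n le_rfl).1, ?_⟩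
  have h4 : ∀ᶠ t in nhdsWithin (0 : ℝ) (Ioi 0),
      ∀ i ∈ Finset.range (n + 1), (-1 : ℝ) ^ i * S t (x i) < 0 := by
    rw [Filter.eventually_all_finset]
    intro i hi
    have hc : Continuous (fun t => (-1 : ℝ) ^ i * S t (x i)) := continuous_const.mul (hS (x i))
    have := hc.continuousAt.eventually_lt (x₀ := (0 : ℝ)) (g := fun _ => (0 : ℝ))
      continuousAt_const (h3 i (by simpa [Nat.lt_succ_iff] using hi))
    exact this.filter_mono nhdsWithin_le_nhds
  filter_upwards [h4] with t ht
  have ht' : ∀ i ≤ n, (-1 : ℝ) ^ i * S t (x i) < 0 := fun i hi =>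
    ht i (by simpa [Nat.lt_succ_iff] using hi)
  exact ⟨⟨x, h1, h2, ht'⟩, fun y hy hyb hs => kk_alt_ext0 ρ n (S t) x h1 h2 ht' y hy hyb hs⟩

lemma kk_alt_step (ρ : ℝ) (n : ℕ) (S : ℝ → ℝ → ℝ) (hA : KkAlt ρ n (S 0))
    (hS : ∀ y, Continuous (fun t => S t y))
    (h : ∀ᶠ t in nhdsWithin (0 : ℝ) (Ioi 0), ∀ᶠ y in nhdsWithin (0 : ℝ) (Ioi 0),
      (-1 : ℝ) ^ (n + 1) * S t y < 0) :
    ∀ᶠ t in nhdsWithin (0 : ℝ) (Ioi 0), KkAlt ρ (n + 1) (S t) := by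
  obtain ⟨b, hb, h1⟩ := kk_alt_open ρ n S hA hS
  filter_upwards [h1, h] with t ht ht2
  exact kk_alt_ext ρ n (S t) ht.1 ht2

lemma kk_near (m : ℕ) (s : ℝ) (T S : ℝ → ℝ) (hT : Continuous T) (hs : s * T 0 < 0)
    (hS : ∀ y, S y = y ^ m * T y) : ∀ᶠ y in nhdsWithin (0 : ℝ) (Ioi 0), s * S y < 0 := by
  have hc : Continuous (fun t => s * T t) := continuous_const.mul hT
  have := hc.continuousAt.eventually_lt (x₀ := (0 : ℝ)) (g := fun _ => (0 : ℝ))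
      continuousAt_const hs
  filter_upwards [this.filter_mono nhdsWithin_le_nhds, self_mem_nhdsWithin] with y h1 h2
  have h3 : 0 < y ^ m := pow_pos h2 m
  rw [hS y]
  have := mul_neg_of_pos_of_neg h3 h1
  calc s * (y ^ m * T y) = y ^ m * (s * T y) := by ring
    _ < 0 := this

/-- Evaluation form of the reduced averaged function. -/
noncomputable def kkE (a1 c2 a3 c3 g0 g1 g2 t3 y : ℝ) : ℝ :=
  g0 + g1 * y + g2 * y ^ 2 + t3 * y ^ 3 + kks4 a1 c2 a3 c3 * y ^ 4 + kks5 a1 c2 a3 c3 * y ^ 5 +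
    kks6 a1 c2 a3 c3 * y ^ 6 + kks7 a1 c2 a3 c3 * y ^ 7 + kks8 a1 c2 a3 c3 * y ^ 8 +
    kks9 a1 c2 a3 c3 * y ^ 9 + kks10 a1 c2 a3 c3 * y ^ 10 + kks11 a1 c2 a3 c3 * y ^ 11

lemma kkS_eval (a1 c2 a3 c3 g0 g1 g2 t3 y : ℝ) :
    (kkS a1 c2 a3 c3 g0 g1 g2 (t3 - kks3 a1 c2 a3 c3)).eval y = kkE a1 c2 a3 c3 g0 g1 g2 t3 y := by
  simp [kkS, kkE]

lemma kks_cont : (Continuous fun p : ℝ × ℝ × ℝ × ℝ => kks4 p.1 p.2.1 p.2.2.1 p.2.2.2) ∧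
    (Continuous fun p : ℝ × ℝ × ℝ × ℝ => kks5 p.1 p.2.1 p.2.2.1 p.2.2.2) ∧
    (Continuous fun p : ℝ × ℝ × ℝ × ℝ => kks6 p.1 p.2.1 p.2.2.1 p.2.2.2) ∧
    (Continuous fun p : ℝ × ℝ × ℝ × ℝ => kks7 p.1 p.2.1 p.2.2.1 p.2.2.2) ∧
    (Continuous fun p : ℝ × ℝ × ℝ × ℝ => kks8 p.1 p.2.1 p.2.2.1 p.2.2.2) ∧
    (Continuous fun p : ℝ × ℝ × ℝ × ℝ => kks9 p.1 p.2.1 p.2.2.1 p.2.2.2) ∧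
    (Continuous fun p : ℝ × ℝ × ℝ × ℝ => kks10 p.1 p.2.1 p.2.2.1 p.2.2.2) ∧
    (Continuous fun p : ℝ × ℝ × ℝ × ℝ => kks11 p.1 p.2.1 p.2.2.1 p.2.2.2) := by
  refine ⟨?_, ?_, ?_, ?_, ?_, ?_, ?_, ?_⟩ <;>
    simp only [kks4, kks5, kks6, kks7, kks8, kks9, kks10, kks11] <;> fun_prop

lemma kkE_cont (a1 c2 a3 c3 g0 g1 g2 t3 : ℝ → ℝ) (h1 : Continuous a1) (h2 : Continuous c2)
    (h3 : Continuous a3) (h4 : Continuous c3) (h5 : Continuous g0) (h6 : Continuous g1)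
    (h7 : Continuous g2) (h8 : Continuous t3) (y : ℝ) :
    Continuous (fun t => kkE (a1 t) (c2 t) (a3 t) (c3 t) (g0 t) (g1 t) (g2 t) (t3 t) y) := by
  have hp : Continuous (fun t => (a1 t, c2 t, a3 t, c3 t)) := by fun_prop
  obtain ⟨k4, k5, k6, k7, k8, k9, k10, k11⟩ := kks_cont
  have k4 := k4.comp hp
  have k5 := k5.comp hp
  have k6 := k6.comp hp
  have k7 := k7.comp hp
  have k8 := k8.comp hp
  have k9 := k9.comp hp
  have k10 := k10.comp hp
  have k11 := k11.comp hp
  simp only [Function.comp_def] at k4 k5 k6 k7 k8 k9 k10 k11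
  simp only [kkE]
  fun_prop

open Set Metric

lemma kks_zero (c2 a3 c3 : ℝ) : kks4 0 c2 a3 c3 = 0 ∧ kks5 0 c2 a3 c3 = 0 ∧
    kks6 0 c2 a3 c3 = c2 * (c2 - 2) * (c2 - 3) / 48 := by
  refine ⟨?_, ?_, ?_⟩ <;> simp only [kks4, kks5, kks6] <;> ring

lemma kk_st0 (ρ : ℝ) (hρ : 0 < ρ) : KkAlt ρ 0 (kkE 0 3 (10 / 3) 6 0 0 0 0) := by
  apply kk_alt_zero ρ hρ
  have := kk_near 9 1 (fun y => kks9 0 3 (10 / 3) 6 + kks10 0 3 (10 / 3) 6 * y +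
    kks11 0 3 (10 / 3) 6 * y ^ 2) (kkE 0 3 (10 / 3) 6 0 0 0 0) (by fun_prop)
    (by norm_num [kks9]) (by
      intro y
      simp only [kkE, kks4, kks5, kks6, kks7, kks8]
      ring)
  simpa using this

lemma kk_st1 (ρ : ℝ) (hρ : 0 < ρ) : ∃ a3 c3 : ℝ, kks7 0 3 a3 c3 = 0 ∧
    KkAlt ρ 1 (kkE 0 3 a3 c3 0 0 0 0) := by
  have h := kk_alt_step ρ 0 (fun t => kkE 0 3 (10 / 3 + 7 * t) (6 + 9 * t) 0 0 0 0)
    (by simpa using kk_st0 ρ hρ)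
    (fun y => kkE_cont (fun _ => 0) (fun _ => 3) (fun t => 10 / 3 + 7 * t) (fun t => 6 + 9 * t)
      (fun _ => 0) (fun _ => 0) (fun _ => 0) (fun _ => 0) (by fun_prop) (by fun_prop) (by fun_prop)
      (by fun_prop) (by fun_prop) (by fun_prop) (by fun_prop) (by fun_prop) y)
    (by
      filter_upwards [self_mem_nhdsWithin] with t ht
      have ht0 : 0 < t := ht
      refine kk_near 8 _ (fun y => kks8 0 3 (10 / 3 + 7 * t) (6 + 9 * t) +
        kks9 0 3 (10 / 3 + 7 * t) (6 + 9 * t) * y + kks10 0 3 (10 / 3 + 7 * t) (6 + 9 * t) * y ^ 2 +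
        kks11 0 3 (10 / 3 + 7 * t) (6 + 9 * t) * y ^ 3) _ (by fun_prop) ?_ ?_
      · have : kks8 0 3 (10 / 3 + 7 * t) (6 + 9 * t) = 63 / 16 * t ^ 2 + 39 / 16 * t := by
          simp only [kks8]
          ring
        have hp : 0 < 63 / 16 * t ^ 2 + 39 / 16 * t := by positivity
        simp only [this]
        norm_num
        linarith
      · intro y
        simp only [kkE, kks4, kks5, kks6, kks7]
        ring)
  obtain ⟨t, ht⟩ := h.exists
  refine ⟨_, _, ?_, ht⟩
  simp only [kks7]
  ring

lemma kk_st2 (ρ : ℝ) (hρ : 0 < ρ) : ∃ a3 c3 : ℝ, KkAlt ρ 2 (kkE 0 3 a3 c3 0 0 0 0) := by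
  obtain ⟨a3, c3, h7, hA⟩ := kk_st1 ρ hρ
  have h := kk_alt_step ρ 1 (fun t => kkE 0 3 (a3 + t) c3 0 0 0 0)
    (by simpa using hA)
    (fun y => kkE_cont (fun _ => 0) (fun _ => 3) (fun t => a3 + t) (fun _ => c3)
      (fun _ => 0) (fun _ => 0) (fun _ => 0) (fun _ => 0) (by fun_prop) (by fun_prop) (by fun_prop)
      (by fun_prop) (by fun_prop) (by fun_prop) (by fun_prop) (by fun_prop) y)
    (by
      filter_upwards [self_mem_nhdsWithin] with t ht
      have ht0 : 0 < t := ht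
      refine kk_near 7 _ (fun y => kks7 0 3 (a3 + t) c3 + kks8 0 3 (a3 + t) c3 * y +
        kks9 0 3 (a3 + t) c3 * y ^ 2 + kks10 0 3 (a3 + t) c3 * y ^ 3 +
        kks11 0 3 (a3 + t) c3 * y ^ 4) _ (by fun_prop) ?_ ?_
      · have : kks7 0 3 (a3 + t) c3 = kks7 0 3 a3 c3 - 9 / 64 * t := by
          simp only [kks7]
          ring
        simp only [this, h7]
        norm_num
        positivity
      · intro y
        simp only [kkE, kks4, kks5, kks6]
        ring)
  obtain ⟨t, ht⟩ := h.exists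
  exact ⟨_, _, ht⟩

lemma kk_st3 (ρ : ℝ) (hρ : 0 < ρ) : ∃ c2 a3 c3 : ℝ,
    3 / 16 + (3 / 32 + 5 / 32 * c2 - 5 / 48 * c2 ^ 2) + c2 * (c2 - 2) * (c2 - 3) / 48 < 0 ∧
    KkAlt ρ 3 (kkE 0 c2 a3 c3 0 0 0 0) := by
  obtain ⟨a3, c3, hA⟩ := kk_st2 ρ hρ
  have h := kk_alt_step ρ 2 (fun t => kkE 0 (3 + t) a3 c3 0 0 0 0)
    (by simpa using hA)
    (fun y => kkE_cont (fun _ => 0) (fun t => 3 + t) (fun _ => a3) (fun _ => c3)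
      (fun _ => 0) (fun _ => 0) (fun _ => 0) (fun _ => 0) (by fun_prop) (by fun_prop) (by fun_prop)
      (by fun_prop) (by fun_prop) (by fun_prop) (by fun_prop) (by fun_prop) y)
    (by
      filter_upwards [self_mem_nhdsWithin] with t ht
      have ht0 : 0 < t := ht
      obtain ⟨h4, h5, h6⟩ := kks_zero (3 + t) a3 c3
      refine kk_near 6 _ (fun y => kks6 0 (3 + t) a3 c3 + kks7 0 (3 + t) a3 c3 * y +
        kks8 0 (3 + t) a3 c3 * y ^ 2 +
        kks9 0 (3 + t) a3 c3 * y ^ 3 + kks10 0 (3 + t) a3 c3 * y ^ 4 +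
        kks11 0 (3 + t) a3 c3 * y ^ 5) _ (by fun_prop) ?_ ?_
      · have : (3 + t) * (3 + t - 2) * (3 + t - 3) / 48 = (3 + t) * (1 + t) * t / 48 := by ring
        simp only [h6, this]
        have : 0 < (3 + t) * (1 + t) * t / 48 := by positivity
        norm_num
        linarith
      · intro y
        simp only [kkE, h4, h5]
        ring)
  have h2 : ∀ᶠ t in nhdsWithin (0 : ℝ) (Ioi 0), 3 / 16 + (3 / 32 + 5 / 32 * (3 + t) -
      5 / 48 * (3 + t) ^ 2) + (3 + t) * ((3 + t) - 2) * ((3 + t) - 3) / 48 < 0 := by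
    have hc : Continuous (fun t : ℝ => 3 / 16 + (3 / 32 + 5 / 32 * (3 + t) -
      5 / 48 * (3 + t) ^ 2) + (3 + t) * ((3 + t) - 2) * ((3 + t) - 3) / 48) := by fun_prop
    have := hc.continuousAt.eventually_lt (x₀ := (0 : ℝ)) (g := fun _ => (0 : ℝ))
      continuousAt_const (by norm_num)
    exact this.filter_mono nhdsWithin_le_nhds
  obtain ⟨t, ht, ht2⟩ := (h.and h2).exists
  exact ⟨_, _, _, ht2, ht⟩

lemma kk_st5 (ρ : ℝ) (hρ : 0 < ρ) : ∃ a1 c2 a3 c3 : ℝ, KkAlt ρ 5 (kkE a1 c2 a3 c3 0 0 0 0) := by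
  obtain ⟨c2, a3, c3, hk, hA⟩ := kk_st3 ρ hρ
  obtain ⟨b, hb, h⟩ := kk_alt_open ρ 3 (fun t => kkE t c2 a3 c3 0 0 0 0) hA
    (fun y => kkE_cont (fun t => t) (fun _ => c2) (fun _ => a3) (fun _ => c3)
      (fun _ => 0) (fun _ => 0) (fun _ => 0) (fun _ => 0) (by fun_prop) (by fun_prop) (by fun_prop)
      (by fun_prop) (by fun_prop) (by fun_prop) (by fun_prop) (by fun_prop) y)
  have h2 : ∀ᶠ t in nhdsWithin (0 : ℝ) (Ioi 0), 1 * kkE t c2 a3 c3 0 0 0 0 t < 0 := by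
    obtain ⟨k4, k5, k6, k7, k8, k9, k10, k11⟩ := kks_cont
    have hp : Continuous (fun t : ℝ => (t, c2, a3, c3)) := by fun_prop
    have k6 := k6.comp hp
    have k7 := k7.comp hp
    have k8 := k8.comp hp
    have k9 := k9.comp hp
    have k10 := k10.comp hp
    have k11 := k11.comp hp
    simp only [Function.comp_def] at k6 k7 k8 k9 k10 k11
    refine kk_near 6 1 (fun t => 3 / 16 - 3 / 32 * t + (3 / 32 + 5 / 32 * c2 - 5 / 48 * c2 ^ 2 +
      t * (-1 / 8 * c2 + 3 / 32 * a3 - 1 / 32 * c3 - 3 / 32)) + kks6 t c2 a3 c3 +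
      kks7 t c2 a3 c3 * t + kks8 t c2 a3 c3 * t ^ 2 + kks9 t c2 a3 c3 * t ^ 3 +
      kks10 t c2 a3 c3 * t ^ 4 + kks11 t c2 a3 c3 * t ^ 5) _ (by fun_prop) ?_ ?_
    · simp only [(kks_zero c2 a3 c3).2.2]
      linarith
    · intro t
      simp only [kkE, kks4, kks5]
      ring
  have h3 : ∀ᶠ t in nhdsWithin (0 : ℝ) (Ioi 0), t ∈ Ioo 0 (min b 2) :=
    Ioo_mem_nhdsGT (lt_min hb two_pos)
  obtain ⟨t, ⟨h4, h5⟩, h6⟩ := ((h.and h2).and h3).exists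
  have h7 := h4.2 t h6.1 (h6.2.trans_le (min_le_left _ _)) (by norm_num at h5 ⊢; exact h5)
  refine ⟨t, c2, a3, c3, kk_alt_ext ρ 4 _ h7 ?_⟩
  have ht2 : t < 2 := h6.2.trans_le (min_le_right _ _)
  have ht0 : 0 < t := h6.1
  refine kk_near 4 _ (fun y => kks4 t c2 a3 c3 + kks5 t c2 a3 c3 * y + kks6 t c2 a3 c3 * y ^ 2 +
      kks7 t c2 a3 c3 * y ^ 3 + kks8 t c2 a3 c3 * y ^ 4 + kks9 t c2 a3 c3 * y ^ 5 +
      kks10 t c2 a3 c3 * y ^ 6 + kks11 t c2 a3 c3 * y ^ 7) _ (by fun_prop) ?_ ?_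
  · have e : kks4 t c2 a3 c3 = 3 / 32 * t ^ 2 * (2 - t) := by
      simp only [kks4]
      ring
    have : 0 < 3 / 32 * t ^ 2 * (2 - t) := mul_pos (by positivity) (by linarith)
    simp only [e]
    norm_num
    linarith
  · intro y
    simp only [kkE]
    ring

lemma kk_st8 (ρ : ℝ) (hρ : 0 < ρ) : ∃ a1 c2 a3 c3 g1 g2 t3 : ℝ,
    KkAlt ρ 8 (kkE a1 c2 a3 c3 0 g1 g2 t3) := by
  obtain ⟨a1, c2, a3, c3, hA⟩ := kk_st5 ρ hρ
  have h := kk_alt_step ρ 5 (fun t => kkE a1 c2 a3 c3 0 0 0 (-t)) (by simpa using hA)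
    (fun y => by simp only [kkE]; fun_prop)
    (by
      filter_upwards [self_mem_nhdsWithin] with t ht
      have ht0 : 0 < t := ht
      refine kk_near 3 _ (fun y => -t + kks4 a1 c2 a3 c3 * y + kks5 a1 c2 a3 c3 * y ^ 2 +
        kks6 a1 c2 a3 c3 * y ^ 3 + kks7 a1 c2 a3 c3 * y ^ 4 + kks8 a1 c2 a3 c3 * y ^ 5 +
        kks9 a1 c2 a3 c3 * y ^ 6 + kks10 a1 c2 a3 c3 * y ^ 7 +
        kks11 a1 c2 a3 c3 * y ^ 8) _ (by fun_prop) (by norm_num; exact ht0) ?_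
      intro y
      simp only [kkE]
      ring)
  obtain ⟨t3, hA⟩ : ∃ t3, KkAlt ρ 6 (kkE a1 c2 a3 c3 0 0 0 t3) := by
    obtain ⟨t, ht⟩ := h.exists
    exact ⟨_, ht⟩
  have h := kk_alt_step ρ 6 (fun t => kkE a1 c2 a3 c3 0 0 t t3) (by simpa using hA)
    (fun y => by simp only [kkE]; fun_prop)
    (by
      filter_upwards [self_mem_nhdsWithin] with t ht
      have ht0 : 0 < t := ht
      refine kk_near 2 _ (fun y => t + t3 * y + kks4 a1 c2 a3 c3 * y ^ 2 +
        kks5 a1 c2 a3 c3 * y ^ 3 +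
        kks6 a1 c2 a3 c3 * y ^ 4 + kks7 a1 c2 a3 c3 * y ^ 5 + kks8 a1 c2 a3 c3 * y ^ 6 +
        kks9 a1 c2 a3 c3 * y ^ 7 + kks10 a1 c2 a3 c3 * y ^ 8 +
        kks11 a1 c2 a3 c3 * y ^ 9) _ (by fun_prop) (by norm_num; exact ht0) ?_
      intro y
      simp only [kkE]
      ring)
  obtain ⟨g2, hA⟩ : ∃ g2, KkAlt ρ 7 (kkE a1 c2 a3 c3 0 0 g2 t3) := by
    obtain ⟨t, ht⟩ := h.exists
    exact ⟨_, ht⟩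
  have h := kk_alt_step ρ 7 (fun t => kkE a1 c2 a3 c3 0 (-t) g2 t3) (by simpa using hA)
    (fun y => by simp only [kkE]; fun_prop)
    (by
      filter_upwards [self_mem_nhdsWithin] with t ht
      have ht0 : 0 < t := ht
      refine kk_near 1 _ (fun y => -t + g2 * y + t3 * y ^ 2 + kks4 a1 c2 a3 c3 * y ^ 3 +
        kks5 a1 c2 a3 c3 * y ^ 4 +
        kks6 a1 c2 a3 c3 * y ^ 5 + kks7 a1 c2 a3 c3 * y ^ 6 + kks8 a1 c2 a3 c3 * y ^ 7 +
        kks9 a1 c2 a3 c3 * y ^ 8 + kks10 a1 c2 a3 c3 * y ^ 9 +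
        kks11 a1 c2 a3 c3 * y ^ 10) _ (by fun_prop) (by norm_num; exact ht0) ?_
      intro y
      simp only [kkE]
      ring)
  obtain ⟨t, ht⟩ := h.exists
  exact ⟨a1, c2, a3, c3, _, g2, t3, ht⟩

lemma kk_st9 (ρ : ℝ) (hρ : 0 < ρ) : ∃ a1 c2 a3 c3 g0 g1 g2 g3 : ℝ,
    KkAlt ρ 9 (fun y => (kkS a1 c2 a3 c3 g0 g1 g2 g3).eval y) ∧
    ∀ z, (kkS a1 c2 a3 c3 g0 g1 g2 g3).eval z = 0 →
      (kkS a1 c2 a3 c3 g0 g1 g2 g3).derivative.eval z ≠ 0 := by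
  obtain ⟨a1, c2, a3, c3, g1, g2, t3, hA⟩ := kk_st8 ρ hρ
  have h := kk_alt_step ρ 8 (fun t => kkE a1 c2 a3 c3 t g1 g2 t3) (by simpa using hA)
    (fun y => by simp only [kkE]; fun_prop)
    (by
      filter_upwards [self_mem_nhdsWithin] with t ht
      have ht0 : 0 < t := ht
      refine kk_near 0 _ (fun y => kkE a1 c2 a3 c3 t g1 g2 t3 y) _ (by simp only [kkE]; fun_prop)
        (by norm_num [kkE]; exact ht0) ?_
      intro y
      simp)
  set P : Polynomial ℝ := kkS a1 c2 a3 c3 0 g1 g2 (t3 - kks3 a1 c2 a3 c3) with hP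
  have hPt : ∀ t, kkS a1 c2 a3 c3 t g1 g2 (t3 - kks3 a1 c2 a3 c3) = Polynomial.C t + P := by
    intro t
    rw [hP]
    simp only [kkS, Polynomial.C_0]
    ring
  have hP' : P.derivative ≠ 0 := by
    intro h0
    have h1 := Polynomial.eq_C_of_derivative_eq_zero h0
    obtain ⟨x, -, -, h3⟩ := hA
    have h3 := h3 0 (Nat.zero_le _)
    rw [← kkS_eval, ← hP, h1] at h3
    have h4 : P.coeff 0 = 0 := by
      rw [Polynomial.coeff_zero_eq_eval_zero, hP, kkS_eval]
      simp [kkE]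
    rw [h4] at h3
    simp at h3
  have hfin : (Set.image (fun z => -P.eval z) (P.derivative.rootSet ℝ) \ {0}).Finite :=
    ((P.derivative.rootSet_finite ℝ).image _).subset sdiff_subset
  have h2 : ∀ᶠ t in nhdsWithin (0 : ℝ) (Ioi 0),
      t ∈ (Set.image (fun z => -P.eval z) (P.derivative.rootSet ℝ) \ {0})ᶜ := by
    apply nhdsWithin_le_nhds
    exact hfin.isClosed.isOpen_compl.mem_nhds (by simp)
  obtain ⟨t, ⟨ht, ht2⟩, ht0⟩ := ((h.and h2).and self_mem_nhdsWithin).exists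
  have ht0 : 0 < t := ht0
  refine ⟨a1, c2, a3, c3, t, g1, g2, t3 - kks3 a1 c2 a3 c3, ?_, ?_⟩
  · simp only [kkS_eval]
    exact ht
  · intro z hz hz'
    rw [hPt] at hz hz'
    apply ht2
    refine ⟨⟨z, ?_, ?_⟩, ht0.ne'⟩
    · rw [Polynomial.mem_rootSet]
      refine ⟨hP', ?_⟩
      simpa using hz'
    · simp at hz
      simp only
      linarith

open Set Metric

lemma kk_roots (r : ℝ) (hr : 0 < r) : ∃ a1 c2 a3 c3 g0 g1 g2 g3 : ℝ, ∃ x : ℕ → ℝ, ∃ y : ℕ → ℝ,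
    (∀ i ≤ 9, 0 < x i ∧ x i < r) ∧ (∀ i < 9, x (i + 1) < y i ∧ y i < x i) ∧
    ∀ i < 9, (kkG (kkf a1 a3) (kkk c2 c3) (kkφ g0 g1 g2 g3)).eval (y i) = 0 ∧
      (kkG (kkf a1 a3) (kkk c2 c3) (kkφ g0 g1 g2 g3)).derivative.eval (y i) ≠ 0 := by
  obtain ⟨a1, c2, a3, c3, g0, g1, g2, g3, ⟨x, h1, h2, h3⟩, hs⟩ :=
    kk_st9 (min r 1) (lt_min hr one_pos)
  have hy : ∀ i < 9, ∃ y, x (i + 1) < y ∧ y < x i ∧ (kkS a1 c2 a3 c3 g0 g1 g2 g3).eval y = 0 := by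
    intro i hi
    have hlt := h2 i hi
    have ha := h3 i hi.le
    have hb := h3 (i + 1) hi
    have hc : ContinuousOn (fun z => (-1 : ℝ) ^ i * (kkS a1 c2 a3 c3 g0 g1 g2 g3).eval z)
        (Icc (x (i + 1)) (x i)) :=
      (continuous_const.mul (Polynomial.continuous _)).continuousOn
    have hb' : 0 < (-1 : ℝ) ^ i * (kkS a1 c2 a3 c3 g0 g1 g2 g3).eval (x (i + 1)) := by
      rw [pow_succ] at hb
      linarith
    obtain ⟨z, hz, hz0⟩ := intermediate_value_Ioo' hlt.le hc ⟨ha, hb'⟩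
    refine ⟨z, hz.1, hz.2, ?_⟩
    have : (-1 : ℝ) ^ i ≠ 0 := pow_ne_zero _ (by norm_num)
    exact (mul_eq_zero.mp hz0).resolve_left this
  choose! y hy using hy
  refine ⟨a1, c2, a3, c3, g0, g1, g2, g3, x, y,
    fun i hi => ⟨(h1 i hi).1, (h1 i hi).2.trans_le (min_le_left _ _)⟩,
    fun i hi => ⟨(hy i hi).1, (hy i hi).2.1⟩, ?_⟩
  intro i hi
  obtain ⟨u1, u2, u3⟩ := hy i hi
  have p0 : 0 < y i := (h1 (i + 1) hi).1.trans u1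
  have p1 : y i < 1 := u2.trans ((h1 i hi.le).2.trans_le (min_le_right _ _))
  rw [kk_gS]
  constructor
  · simp [u3]
  · rw [Polynomial.derivative_mul]
    simp only [Polynomial.eval_add, Polynomial.eval_mul, u3, mul_zero, zero_add,
      Polynomial.eval_X, Polynomial.eval_sub, Polynomial.eval_one]
    exact mul_ne_zero (mul_ne_zero p0.ne' (by linarith)) (hs _ u3)

/-- The planar angular function. -/
noncomputable def kkQ (a1 c2 a3 c3 g0 g1 g2 g3 e x y : ℝ) : ℝ :=
  (1 - x ^ 2 - y ^ 2) * (
    e * (a1 * (x ^ 2 + y ^ 2 + 2 * (x ^ 2 - y ^ 2)) +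
      ((x ^ 2 + y ^ 2) ^ 2 + 2 * (x ^ 2 + y ^ 2) * (x ^ 2 - y ^ 2) +
        c2 * (2 * (x ^ 2 - y ^ 2) ^ 2 - (x ^ 2 + y ^ 2) ^ 2)) +
      (a3 * ((x ^ 2 + y ^ 2) ^ 3 + 2 * (x ^ 2 + y ^ 2) ^ 2 * (x ^ 2 - y ^ 2)) +
        c3 * (x ^ 2 + y ^ 2) * (2 * (x ^ 2 - y ^ 2) ^ 2 - (x ^ 2 + y ^ 2) ^ 2))) +
    e ^ 3 * (g0 + g1 * (x ^ 2 + y ^ 2) + g2 * (x ^ 2 + y ^ 2) ^ 2 + g3 * (x ^ 2 + y ^ 2) ^ 3))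

lemma kkQ_polar (a1 c2 a3 c3 g0 g1 g2 g3 e R θ : ℝ) (hR : 0 < R) :
    kkQ a1 c2 a3 c3 g0 g1 g2 g3 e (√R * Real.cos θ) (√R * Real.sin θ) =
      e * kkF (kkf a1 a3) (kkk c2 c3) (kkφ g0 g1 g2 g3)
        (e, R, Real.cos (2 * θ), Real.sin (2 * θ)) := by
  have hs : √R ^ 2 = R := Real.sq_sqrt hR.le
  have h1 : (√R * Real.cos θ) ^ 2 + (√R * Real.sin θ) ^ 2 = R := by
    rw [mul_pow, mul_pow, hs, ← mul_add, Real.cos_sq_add_sin_sq, mul_one]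
  have h2 : (√R * Real.cos θ) ^ 2 - (√R * Real.sin θ) ^ 2 = R * Real.cos (2 * θ) := by
    rw [mul_pow, mul_pow, hs, ← mul_sub, Real.cos_two_mul']
  have p0 : (kkφ g0 g1 g2 g3).eval R = (1 - R) * (g0 + g1 * R + g2 * R ^ 2 + g3 * R ^ 3) := by
    simp [kkφ]
  simp only [kkQ, kkF, (kkf_ev a1 a3 R).1, (kkk_ev c2 c3 R).1, p0, sub_sub, h1, h2]
  ring

lemma kkQ_sol (a1 c2 a3 c3 g0 g1 g2 g3 e : ℝ) : ∃ b00 b20 b02 b40 b22 b04 b60 b42 b24 b06 : ℝ,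
    ∀ γ : ℝ → ℝ × ℝ, IsKukles9Sol b00 b20 b02 b40 b22 b04 b60 b42 b24 b06 γ ↔
      KkSol (kkQ a1 c2 a3 c3 g0 g1 g2 g3 e) γ := by
  refine ⟨e ^ 3 * g0, 3 * e * a1 + e ^ 3 * g1, -e * a1 + e ^ 3 * g1,
    e * (3 + c2) + e ^ 3 * g2, e * (2 - 6 * c2) + e ^ 3 * (2 * g2), e * (-1 + c2) + e ^ 3 * g2,
    e * (3 * a3 + c3) + e ^ 3 * g3, e * (5 * a3 - 5 * c3) + e ^ 3 * (3 * g3),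
    e * (a3 - 5 * c3) + e ^ 3 * (3 * g3), e * (-a3 + c3) + e ^ 3 * g3, ?_⟩
  intro γ
  unfold IsKukles9Sol KkSol
  refine forall_congr' fun t => ?_
  generalize (γ t).1 = x
  generalize (γ t).2 = y
  rw [← eq_iff_iff]
  congr 2
  simp only [kkQ]
  ring


/-- For every `r > 0` there are coefficients such that the degree-9
Kukles system has at least 9 limit cycles with pairwise distinct images, all
contained in the open ball of radius `r` about the origin, each isolated among
periodic orbits. -/
theorem kukles_degree9_nine_limit_cycles (r : ℝ) (hr : 0 < r) :
    ∃ b00 b20 b02 b40 b22 b04 b60 b42 b24 b06 : ℝ,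
      ∃ Γ : Fin 9 → Set (ℝ × ℝ),
        Function.Injective Γ ∧
        ∀ k : Fin 9,
          Γ k ⊆ {p : ℝ × ℝ | p.1 ^ 2 + p.2 ^ 2 < r ^ 2} ∧
          (∃ γ : ℝ → ℝ × ℝ,
            IsKukles9Sol b00 b20 b02 b40 b22 b04 b60 b42 b24 b06 γ ∧
            IsPeriodicCurve γ ∧ IsNonconstCurve γ ∧ Set.range γ = Γ k) ∧
          (∃ U : Set (ℝ × ℝ), IsOpen U ∧ Γ k ⊆ U ∧
            ∀ γ : ℝ → ℝ × ℝ,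
              IsKukles9Sol b00 b20 b02 b40 b22 b04 b60 b42 b24 b06 γ →
              IsPeriodicCurve γ → IsNonconstCurve γ → Set.range γ ⊆ U →
                Set.range γ = Γ k) := by
  obtain ⟨a1, c2, a3, c3, g0, g1, g2, g3, x, y, h1, h2, h3⟩ := kk_roots (r ^ 2) (by positivity)
  have hA : ∀ k : Fin 9, ∃ δ > 0, x (k + 1) < y k - δ ∧ y k + δ < x k ∧ _ := fun k =>
    kk_A (kkf a1 a3) (kkk c2 c3) (kkφ g0 g1 g2 g3) (y k) (x (k + 1)) (x k) (h2 k k.2).1 (h2 k k.2).2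
      (h3 k k.2).1 (h3 k k.2).2
  choose δ hδ hlo hhi hev using hA
  obtain ⟨e, he⟩ := (Filter.eventually_all.2 hev).exists
  have hpos : ∀ k : Fin 9, 0 < y k - δ k := fun k => (h1 (k + 1) k.2).1.trans (hlo k)
  have hcyc := fun k : Fin 9 => kk_cycle (kkQ a1 c2 a3 c3 g0 g1 g2 g3 e)
    (by unfold kkQ; fun_prop)
    (fun R θ => e * kkF (kkf a1 a3) (kkk c2 c3) (kkφ g0 g1 g2 g3)
        (e, R, Real.cos (2 * θ), Real.sin (2 * θ)))
    (fun R θ hR => kkQ_polar a1 c2 a3 c3 g0 g1 g2 g3 e R θ hR)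
    (y k - δ k) (y k + δ k) (hpos k) (he k).1 (he k).2
  choose Γ hne hsub hsol hiso using hcyc
  obtain ⟨b00, b20, b02, b40, b22, b04, b60, b42, b24, b06, hb⟩ :=
    kkQ_sol a1 c2 a3 c3 g0 g1 g2 g3 e
  refine ⟨b00, b20, b02, b40, b22, b04, b60, b42, b24, b06, Γ, ?_, ?_⟩
  · have hmono : ∀ i j : ℕ, i ≤ j → j ≤ 9 → x j ≤ x i := by
      intro i j hij
      induction j, hij using Nat.le_induction with
      | base => intro _; exact le_rfl
      | succ j hj ih =>
        intro h9
        have := h2 j (by omega)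
        linarith [ih (by omega)]
    have key : ∀ i j : Fin 9, i < j → Γ i ≠ Γ j := by
      intro i j hij heq
      obtain ⟨p, hp⟩ := hne i
      have q1 := (hsub i hp).1
      rw [heq] at hp
      have q2 := (hsub j hp).2
      have hij' : (i : ℕ) + 1 ≤ j := hij
      have := hmono (i + 1) j hij' (by omega)
      linarith [hlo i, hhi j]
    intro i j hij
    by_contra hne'
    rcases lt_or_gt_of_ne hne' with h | h
    · exact key i j h hij
    · exact key j i h hij.symm
  · intro k
    refine ⟨?_, ?_, ?_⟩
    · intro p hp
      have q := (hsub k hp).2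
      have q2 := (h1 k k.2.le).2
      show p.1 ^ 2 + p.2 ^ 2 < r ^ 2
      linarith [hhi k]
    · obtain ⟨γ, g1, g2, g3, g4⟩ := hsol k
      exact ⟨γ, (hb γ).2 g1, g2, g3, g4⟩
    · obtain ⟨U, u1, u2, u3⟩ := hiso k
      exact ⟨U, u1, u2, fun γ q1 => u3 γ ((hb γ).1 q1)⟩
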